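/- arXiv:0709.1515 — 8 statements merged into one kernel-verified Lean document; each statement's English description precedes it below -/
import Mathlib

section
/- Let R be a nonzero left-Artinian ring. Then there exists a finite set {e₁, …, e_t} of nonzero central idempotents of R which are pairwise orthogonal (eᵢ·eⱼ = 0 for i ≠ j), satisfy e₁ + ⋯ + e_t = 1, and are each primitive among central idempotents (no eᵢ can be written as f + g with f and g nonzero orthogonal central idempotents of R). Moreover this set is unique: any finite set of nonzero, pairwise orthogonal, primitive central idempotents of R summing to 1 coincides with {e₁, …, e_t}. -/
/-- A nonzero central idempotent that is not a sum of two nonzero orthogonal central idempotents. -/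
def IsPrimitiveCentralIdempotent {R : Type*} [Ring R] (e : R) : Prop :=
  e ≠ 0 ∧ e ∈ Subring.center R ∧ e * e = e ∧
    ∀ f g : R, f ∈ Subring.center R → g ∈ Subring.center R →
      f * f = f → g * g = g → f ≠ 0 → g ≠ 0 → f * g = 0 → g * f = 0 → e ≠ f + g

namespace IsPrimitiveCentralIdempotent

variable {R : Type*} [Ring R] {e f : R}

/-- A primitive central idempotent is absorbed by every central idempotent not annihilating it. -/
theorem mul_eq_left (he : IsPrimitiveCentralIdempotent e) (hf : f ∈ Subring.center R)
    (hff : f * f = f) (hef : e * f ≠ 0) : e * f = e := by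
  obtain ⟨-, hec, hee, hprim⟩ := he
  have hcomm : f * e = e * f := (Subring.mem_center_iff.mp hf e).symm
  have hidem : e * f * (e * f) = e * f := by
    rw [mul_assoc, ← mul_assoc f, hcomm, mul_assoc e f f, hff, ← mul_assoc, hee]
  have hleft : e * (e * f) = e * f := by rw [← mul_assoc, hee]
  have hright : e * f * e = e * f := by rw [mul_assoc, hcomm, hleft]
  by_contra hne
  refine hprim (e * f) (e - e * f) (mul_mem hec hf) (sub_mem hec (mul_mem hec hf)) hidem ?_ hef
    (sub_ne_zero.mpr (Ne.symm hne)) ?_ ?_ (by abel)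
  · rw [mul_sub, sub_mul, sub_mul, hee, hright, hleft, hidem]
    abel
  · rw [mul_sub, hright, hidem, sub_self]
  · rw [sub_mul, hleft, hidem, sub_self]

/-- Primitive central idempotents that are not orthogonal are equal. -/
theorem eq_of_mul_ne_zero (he : IsPrimitiveCentralIdempotent e)
    (hf : IsPrimitiveCentralIdempotent f) (hef : e * f ≠ 0) : e = f := by
  have hcomm : f * e = e * f := (Subring.mem_center_iff.mp hf.2.1 e).symm
  rw [← he.mul_eq_left hf.2.1 hf.2.2.1 hef, ← hcomm]
  exact hf.mul_eq_left he.2.1 he.2.2.1 (hcomm ▸ hef)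

/-- A primitive central idempotent belongs to every finite set of primitive central idempotents
with sum `1`. -/
theorem mem_of_sum_eq_one (he : IsPrimitiveCentralIdempotent e) {E : Finset R}
    (hE : ∀ f ∈ E, IsPrimitiveCentralIdempotent f) (hsum : ∑ f ∈ E, f = 1) : e ∈ E := by
  have hne : ∑ f ∈ E, e * f ≠ 0 := by
    rw [← Finset.mul_sum, hsum, mul_one]
    exact he.1
  obtain ⟨f, hf, hef⟩ := Finset.exists_ne_zero_of_sum_ne_zero hne
  exact he.eq_of_mul_ne_zero (hE f hf) hef ▸ hf

end IsPrimitiveCentralIdempotent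

/-- Multiplying a sum of pairwise orthogonal idempotents by one of them returns that one. -/
theorem Finset.mul_sum_eq_self_of_orthogonal {R : Type*} [Ring R] {E : Finset R} {p : R}
    (hp : p ∈ E) (hpp : p * p = p) (horth : ∀ q ∈ E, p ≠ q → p * q = 0) :
    p * ∑ q ∈ E, q = p := by
  rw [Finset.mul_sum, Finset.sum_eq_single_of_mem p hp fun q hq hne => horth q hq hne.symm, hpp]

theorem Ideal.span_singleton_lt_of_orthogonal {R : Type*} [Ring R] {f g : R}
    (hff : f * f = f) (hgg : g * g = g) (hg : g ≠ 0) (hfg : f * g = 0) :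
    Ideal.span {f} < Ideal.span {f + g} := by
  refine lt_of_le_of_ne ?_ fun heq => hg ?_
  · rw [Ideal.span_singleton_le_iff_mem, Ideal.mem_span_singleton']
    exact ⟨f, by rw [mul_add, hff, hfg, add_zero]⟩
  · have hmem : f + g ∈ Ideal.span {f} := heq ▸ Ideal.mem_span_singleton_self _
    obtain ⟨a, ha⟩ := Ideal.mem_span_singleton'.mp hmem
    calc g = (f + g) * g := by rw [add_mul, hfg, hgg, zero_add]
      _ = 0 := by rw [← ha, mul_assoc, hfg, mul_zero]

/-- In a left-Artinian ring every central idempotent is a finite sum of pairwise orthogonal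
primitive central idempotents. -/
theorem exists_finset_isPrimitiveCentralIdempotent_sum_eq {R : Type*} [Ring R] [IsArtinianRing R]
    (e : R) (hec : e ∈ Subring.center R) (hee : e * e = e) :
    ∃ E : Finset R, (∀ p ∈ E, IsPrimitiveCentralIdempotent p) ∧
      (∀ p ∈ E, ∀ q ∈ E, p ≠ q → p * q = 0) ∧ ∑ p ∈ E, p = e := by
  classical
  induction e using (InvImage.wf (fun e : R => Ideal.span {e}) wellFounded_lt).induction with
  | _ e ih =>
  by_cases he0 : e = 0
  · exact ⟨∅, by simp, by simp, by simp [he0]⟩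
  by_cases hprim : IsPrimitiveCentralIdempotent e
  · exact ⟨{e}, by simpa using hprim, by simp, by simp⟩
  obtain ⟨f, g, hf, hg, hff, hgg, hf0, hg0, hfg, hgf, rfl⟩ : ∃ f g : R, f ∈ Subring.center R ∧
      g ∈ Subring.center R ∧ f * f = f ∧ g * g = g ∧ f ≠ 0 ∧ g ≠ 0 ∧ f * g = 0 ∧ g * f = 0 ∧
      e = f + g := by
    by_contra hsplit
    exact hprim ⟨he0, hec, hee, fun f g hf hg hff hgg hf0 hg0 hfg hgf h =>
      hsplit ⟨f, g, hf, hg, hff, hgg, hf0, hg0, hfg, hgf, h⟩⟩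
  obtain ⟨F, hF, hForth, hFsum⟩ :=
    ih f (Ideal.span_singleton_lt_of_orthogonal hff hgg hg0 hfg) hf hff
  obtain ⟨G, hG, hGorth, hGsum⟩ :=
    ih g (add_comm g f ▸ Ideal.span_singleton_lt_of_orthogonal hgg hff hf0 hgf) hg hgg
  have hFG : ∀ p ∈ F, ∀ q ∈ G, p * q = 0 := fun p hp q hq => by
    have hpf : p * f = p :=
      hFsum ▸ Finset.mul_sum_eq_self_of_orthogonal hp (hF p hp).2.2.1 (hForth p hp)
    have hqg : q * g = q :=
      hGsum ▸ Finset.mul_sum_eq_self_of_orthogonal hq (hG q hq).2.2.1 (hGorth q hq)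
    rw [← hpf, ← hqg, Subring.mem_center_iff.mp hg q, mul_assoc, ← mul_assoc f, hfg, zero_mul,
      mul_zero]
  have hdisj : Disjoint F G := Finset.disjoint_left.mpr fun p hpF hpG =>
    (hF p hpF).1 ((hF p hpF).2.2.1 ▸ hFG p hpF p hpG)
  refine ⟨F ∪ G, fun p hp => (Finset.mem_union.mp hp).elim (hF p) (hG p), fun p hp q hq hne => ?_,
    by rw [Finset.sum_union hdisj, hFsum, hGsum]⟩
  rcases Finset.mem_union.mp hp with hp | hp <;> rcases Finset.mem_union.mp hq with hq | hq
  · exact hForth p hp q hq hne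
  · exact hFG p hp q hq
  · rw [Subring.mem_center_iff.mp (hF q hq).2.1 p, hFG q hq p hp]
  · exact hGorth p hp q hq hne


/-- Existence and uniqueness of the complete set of primitive orthogonal central
idempotents in a nonzero left-Artinian ring: there exists a unique finite set `E`
of nonzero central idempotents of `R` which are pairwise orthogonal, sum to `1`,
and are each primitive among central idempotents (no element of `E` is a sum of
two nonzero orthogonal central idempotents). -/
theorem artinian_exists_unique_primitive_central_idempotents
    {R : Type*} [Ring R] [IsArtinianRing R] [Nontrivial R] :
    ∃! E : Finset R,
      (∀ e ∈ E, e ≠ 0 ∧ e ∈ Subring.center R ∧ e * e = e ∧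
        ∀ f g : R, f ∈ Subring.center R → g ∈ Subring.center R →
          f * f = f → g * g = g → f ≠ 0 → g ≠ 0 → f * g = 0 → g * f = 0 →
            e ≠ f + g) ∧
      (∀ e ∈ E, ∀ f ∈ E, e ≠ f → e * f = 0) ∧
      (∑ e ∈ E, e) = 1 := by
  obtain ⟨E, hE, horth, hsum⟩ :=
    exists_finset_isPrimitiveCentralIdempotent_sum_eq (1 : R) (one_mem _) (one_mul 1)
  refine ⟨E, ⟨hE, horth, hsum⟩, fun E' ⟨hE', _, hsum'⟩ => ?_⟩
  exact Finset.Subset.antisymm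
    (fun e he => IsPrimitiveCentralIdempotent.mem_of_sum_eq_one (hE' e he) hE hsum)
    fun e he => IsPrimitiveCentralIdempotent.mem_of_sum_eq_one (hE e he) hE' hsum'
end

section
/- Let R be a left-Artinian ring and let S be a multiplicative submonoid of the center Z(R). Then there exists a central idempotent e ∈ R such that: (i) the two-sided ideal of R generated by 1 − e equals {r ∈ R : s·r = 0 for some s ∈ S}; (ii) the quotient map π : R → R/(1 − e) maps every element of S to a unit; (iii) π is universal among S-inverting homomorphisms, i.e., every ring homomorphism f : R → T with f(s) a unit for every s ∈ S factors uniquely through π. (Hence every central localization of a left-Artinian ring is a quotient, obtained by inverting a single central idempotent.) -/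
universe u v

/-- A submonoid `S` of a left-Artinian ring contains an element `s` with
`s = b * t * s` solvable in `b` for every `t ∈ S`. -/
lemma exists_mem_forall_exists_eq_mul_mul {R : Type u} [Ring R] [IsArtinianRing R]
    (S : Submonoid R) :
    ∃ s ∈ S, ∀ t ∈ S, ∃ b : R, s = b * t * s := by
  obtain ⟨I, ⟨s, hs, rfl⟩, hmin⟩ := IsArtinian.set_has_minimal
    ((fun s : R => Submodule.span R {s}) '' (S : Set R)) ⟨_, 1, S.one_mem, rfl⟩
  refine ⟨s, hs, fun t ht => ?_⟩
  have hle : Submodule.span R {t * s} ≤ Submodule.span R {s} := by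
    rw [Submodule.span_singleton_le_iff_mem, Submodule.mem_span_singleton]
    exact ⟨t, rfl⟩
  have heq := hle.eq_of_not_lt (hmin _ ⟨t * s, S.mul_mem ht hs, rfl⟩)
  have hmem : s ∈ Submodule.span R {t * s} := heq ▸ Submodule.mem_span_singleton_self s
  obtain ⟨b, hb⟩ := Submodule.mem_span_singleton.1 hmem
  exact ⟨b, by rw [mul_assoc]; exact hb.symm⟩

/-- If `s` is central and `s = a * s * s`, then `a * s` is idempotent. -/
lemma mul_self_of_eq_mul_mul {R : Type u} [Ring R] {a s : R}
    (hs : ∀ r, r * s = s * r) (ha : s = a * s * s) : a * s * (a * s) = a * s := by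
  rw [mul_assoc, ← hs (a * s), ← ha]

/-- If `s` is central and `s = a * s * s`, then `a * s` is central. -/
lemma mul_mem_center_of_eq_mul_mul {R : Type u} [Ring R] {a s : R}
    (hs : ∀ r, r * s = s * r) (ha : s = a * s * s) : a * s ∈ Subring.center R := by
  rw [Subring.mem_center_iff]
  intro r
  have hes (x : R) : a * s * x * s = x * s := by
    rw [mul_assoc (a * s), hs x, ← mul_assoc, ← ha]
  have hse (x : R) : x * (a * s) * s = x * s := by rw [mul_assoc, ← ha]
  have hd : (a * s * r - r * (a * s)) * s = 0 := by
    rw [sub_mul, hes, hse, sub_self]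
  have hl : a * s * (a * s * r - r * (a * s)) = 0 := by
    rw [mul_assoc, ← hs, hd, mul_zero]
  have hr : (a * s * r - r * (a * s)) * (a * s) = 0 := by
    rw [← mul_assoc, hs, ← mul_assoc, ← hs, hd, zero_mul]
  have hidem : a * s * (a * s) = a * s := mul_self_of_eq_mul_mul hs ha
  rw [mul_sub, ← mul_assoc, hidem, sub_eq_zero] at hl
  rw [sub_mul, mul_assoc r, hidem, sub_eq_zero] at hr
  rw [hl, ← mul_assoc (a * s), hr]

/-- For a central idempotent `e`, the two-sided ideal generated by `1 - e` is the
annihilator of `e`. -/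
lemma mem_span_one_sub_iff {R : Type u} [Ring R] {e : R} (he : e ∈ Subring.center R)
    (hidem : e * e = e) (r : R) :
    r ∈ TwoSidedIdeal.span ({1 - e} : Set R) ↔ e * r = 0 := by
  rw [Subring.mem_center_iff] at he
  constructor
  · intro h
    rw [TwoSidedIdeal.mem_span_iff] at h
    have := h (TwoSidedIdeal.mk' {x | e * x = 0} (by simp)
      (fun {x y} hx hy => by simp_all [mul_add]) (fun {x} hx => by simp_all)
      (fun {x y} hy => by
        simp only [Set.mem_ofPred_eq] at hy ⊢
        rw [← mul_assoc, ← he, mul_assoc, hy, mul_zero])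
      (fun {x y} hx => by
        simp only [Set.mem_ofPred_eq] at hx ⊢
        rw [← mul_assoc, hx, zero_mul]))
      (by
        rw [Set.singleton_subset_iff, SetLike.mem_coe, TwoSidedIdeal.mem_mk']
        simp [mul_sub, hidem])
    rwa [TwoSidedIdeal.mem_mk'] at this
  · intro h
    have hr : r = (1 - e) * r := by rw [sub_mul, h, one_mul, sub_zero]
    rw [hr]
    exact TwoSidedIdeal.mul_mem_right _ _ _ (TwoSidedIdeal.subset_span rfl)

/-- Every central localization of a left-Artinian ring is a quotient, obtained by
inverting a single central idempotent: for a multiplicative submonoid `S` of the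
center of a left-Artinian ring `R`, there is a central idempotent `e` such that
(i) the two-sided ideal generated by `1 - e` is the `S`-torsion
`{r : R | ∃ s ∈ S, s * r = 0}`; (ii) the quotient map `π : R → R/(1 - e)` maps every
element of `S` to a unit; and (iii) `π` is universal among `S`-inverting ring
homomorphisms. -/
theorem artinian_central_localization_is_quotient
    {R : Type u} [Ring R] [IsArtinianRing R]
    (S : Submonoid R) (hS : (S : Set R) ⊆ Subring.center R) :
    ∃ e : R, e ∈ Subring.center R ∧ e * e = e ∧
      (∀ r : R, r ∈ TwoSidedIdeal.span ({1 - e} : Set R) ↔ ∃ s ∈ S, s * r = 0) ∧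
      (∀ s ∈ S, IsUnit ((TwoSidedIdeal.span ({1 - e} : Set R)).ringCon.mk' s)) ∧
      (∀ (T : Type v) [Ring T] (f : R →+* T), (∀ s ∈ S, IsUnit (f s)) →
        ∃! g : (TwoSidedIdeal.span ({1 - e} : Set R)).ringCon.Quotient →+* T,
          g.comp (TwoSidedIdeal.span ({1 - e} : Set R)).ringCon.mk' = f) := by
  obtain ⟨s, hs, hdiv⟩ := exists_mem_forall_exists_eq_mul_mul S
  have hcomm (t : R) (ht : t ∈ S) (r : R) : r * t = t * r :=
    Subring.mem_center_iff.1 (hS ht) r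
  obtain ⟨a, ha⟩ := hdiv s hs
  have hcen : a * s ∈ Subring.center R := mul_mem_center_of_eq_mul_mul (hcomm s hs) ha
  have hidem : a * s * (a * s) = a * s := mul_self_of_eq_mul_mul (hcomm s hs) ha
  have hspan := mem_span_one_sub_iff hcen hidem
  refine ⟨a * s, hcen, hidem, fun r => ?_, fun t ht => ?_, fun T _ f hf => ?_⟩
  · rw [hspan]
    constructor
    · intro h
      refine ⟨s, hs, ?_⟩
      rw [ha, mul_assoc (a * s), ← hcomm s hs r, ← mul_assoc, h, zero_mul]
    · rintro ⟨t, ht, htr⟩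
      obtain ⟨b, hb⟩ := hdiv t ht
      have hsr : s * r = 0 := by
        rw [hb, mul_assoc, ← hcomm s hs r, mul_assoc, ← mul_assoc t, htr, zero_mul, mul_zero]
      rw [mul_assoc, hsr, mul_zero]
  · obtain ⟨b, hb⟩ := hdiv t ht
    have hmk : (TwoSidedIdeal.span ({1 - a * s} : Set R)).ringCon.mk' (a * s) = 1 := by
      rw [← map_one (TwoSidedIdeal.span ({1 - a * s} : Set R)).ringCon.mk', eq_comm]
      refine (RingCon.eq _).2 ((TwoSidedIdeal.rel_iff _ _ _).2 ?_)
      exact TwoSidedIdeal.subset_span rfl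
    have hinv : a * s = a * b * s * t := by
      rw [mul_assoc (a * b), hcomm t ht s, mul_assoc a, ← mul_assoc b, ← hb]
    refine isUnit_iff_exists.2
      ⟨(TwoSidedIdeal.span ({1 - a * s} : Set R)).ringCon.mk' (a * b * s), ?_, ?_⟩
    · rw [← map_mul, ← hcomm t ht, ← hinv, hmk]
    · rw [← map_mul, ← hinv, hmk]
  · have hker (x : R) (hx : x ∈ TwoSidedIdeal.span ({1 - a * s} : Set R)) : f x = 0 := by
      have hsx : s * x = 0 := by
        rw [ha, mul_assoc (a * s), ← hcomm s hs x, ← mul_assoc, (hspan x).1 hx, zero_mul]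
      rw [← (hf s hs).mul_right_eq_zero, ← map_mul, hsx, map_zero]
    refine ⟨RingCon.lift _ f fun x y hxy => ?_, ?_, ?_⟩
    · rw [TwoSidedIdeal.rel_iff] at hxy
      have := hker _ hxy
      rwa [map_sub, sub_eq_zero] at this
    · ext x
      rfl
    · intro g hg
      subst hg
      ext x
      rfl
end

section
/- Let R be a left-Artinian ring, let s₁, …, s_l be elements of the center Z(R), and let S be the multiplicative submonoid of Z(R) generated by s₁, …, s_l. Let n₀ be a positive integer such that r^{n₀} = 0 for every nilpotent element r of R. Then {r ∈ R : s·r = 0 for some s ∈ S} = Σᵢ₌₁^l {r ∈ R : sᵢ^{n₀}·r = 0}, i.e., the S-torsion of R equals the sum of the annihilator ideals (sᵢ^{n₀})^⊥ := {r ∈ R : sᵢ^{n₀}·r = 0}. -/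
/-- In a left-Artinian ring, a central element `s` is, up to a factor killed by `s ^ n`,
left invertible, where `n` bounds the nilpotency indices of the nilpotent elements. -/
theorem exists_pow_mul_one_sub_mul_eq_zero_of_mem_center {R : Type*} [Ring R] [IsArtinianRing R]
    {s : R} (hs : s ∈ Subring.center R) {n : ℕ} (hn : 0 < n)
    (hnil : ∀ r : R, IsNilpotent r → r ^ n = 0) :
    ∃ x : R, s ^ n * (1 - x * s) = 0 := by
  have hcomm (k : ℕ) (r : R) : r * s ^ k = s ^ k * r :=
    Subring.mem_center_iff.1 (pow_mem hs k) r
  have hpow (k : ℕ) (y : R) : (LinearMap.toSpanSingleton R R s ^ k) y = y * s ^ k := by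
    induction k with
    | zero => simp
    | succ k ih => rw [pow_succ', Module.End.mul_apply, ih]; simp [pow_succ, mul_assoc]
  obtain ⟨N, hN, hN0⟩ :=
    ((LinearMap.toSpanSingleton R R s).eventually_codisjoint_ker_pow_range_pow.and
      (Filter.eventually_gt_atTop 0)).exists
  obtain ⟨b, hb, _, ⟨x, rfl⟩, hab⟩ :=
    Submodule.mem_sup.1 (hN.eq_top ▸ Submodule.mem_top : (1 : R) ∈ _)
  rw [LinearMap.mem_ker, hpow] at hb
  rw [hpow] at hab
  obtain ⟨m, rfl⟩ := Nat.exists_eq_succ_of_ne_zero hN0.ne'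
  have hb_eq : b = 1 - x * s ^ (m + 1) := eq_sub_of_add_eq hab
  have hidem : IsIdempotentElem b := by
    have h : x * s ^ (m + 1) * b = 0 := by rw [mul_assoc, ← hcomm, hb, mul_zero]
    calc b * b = (b + x * s ^ (m + 1)) * b := by rw [add_mul, h, add_zero]
      _ = b := by rw [hab, one_mul]
  have hsb : Commute s b := (Subring.mem_center_iff.1 hs b).symm
  have hnilp : IsNilpotent (s * b) :=
    ⟨m + 1, by rw [hsb.mul_pow, hidem.pow_succ_eq, ← hcomm, hb]⟩
  refine ⟨x * s ^ m, ?_⟩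
  obtain ⟨k, rfl⟩ := Nat.exists_eq_succ_of_ne_zero hn.ne'
  rw [mul_assoc, ← pow_succ, ← hb_eq]
  simpa [hsb.mul_pow, hidem.pow_succ_eq] using hnil _ hnilp

/-- Let `R` be a left-Artinian ring, `s₁, …, s_l` central elements, `S` the
multiplicative submonoid generated by them, and `n₀ > 0` such that `r ^ n₀ = 0` for
every nilpotent `r` of `R`.  Then the `S`-torsion `{r : R | ∃ s ∈ S, s * r = 0}`
equals the sum of the annihilator ideals `(sᵢ ^ n₀)^⊥ = {r : R | sᵢ ^ n₀ * r = 0}`. -/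
theorem artinian_torsion_eq_sum_annihilators
    {R : Type*} [Ring R] [IsArtinianRing R] {l : ℕ} (s : Fin l → R)
    (hc : ∀ i, s i ∈ Subring.center R)
    (n₀ : ℕ) (hn₀ : 0 < n₀)
    (hnil : ∀ r : R, IsNilpotent r → r ^ n₀ = 0) (r : R) :
    (∃ σ ∈ Submonoid.closure (Set.range s), σ * r = 0) ↔
      ∃ f : Fin l → R, (∀ i, (s i) ^ n₀ * f i = 0) ∧ r = ∑ i, f i := by
  have hS : Submonoid.closure (Set.range s) ≤ (Subring.center R).toSubmonoid :=
    Submonoid.closure_le.2 (Set.range_subset_iff.2 hc)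
  constructor
  · rintro ⟨σ, hσ, hr⟩
    induction hσ using Submonoid.closure_induction_left generalizing r with
    | one => exact ⟨0, by simp, by simpa using hr⟩
    | mul_left t ht τ hτ ih =>
      obtain ⟨i, rfl⟩ := ht
      obtain ⟨x, hx⟩ := exists_pow_mul_one_sub_mul_eq_zero_of_mem_center (hc i) hn₀ hnil
      have hkill : τ * (x * s i * r) = 0 := by
        rw [← mul_assoc, ← Subring.mem_center_iff.1 (hS hτ), mul_assoc, mul_assoc,
          ← mul_assoc (s i), hr, mul_zero]
      obtain ⟨f, hf, hfr⟩ := ih _ hkill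
      refine ⟨f + Pi.single i ((1 - x * s i) * r), fun j => ?_, ?_⟩
      · rw [Pi.add_apply, mul_add, hf, zero_add]
        obtain rfl | hj := eq_or_ne j i
        · rw [Pi.single_eq_same, ← mul_assoc, hx, zero_mul]
        · rw [Pi.single_eq_of_ne hj, mul_zero]
      · simp [Finset.sum_add_distrib, ← hfr, sub_mul]
  · rintro ⟨f, hf, rfl⟩
    refine Finset.sum_induction f
      (fun r => ∃ σ ∈ Submonoid.closure (Set.range s), σ * r = 0) ?_ ⟨1, one_mem _, by simp⟩
      fun i _ => ⟨s i ^ n₀, pow_mem (Submonoid.subset_closure (Set.mem_range_self i)) _, hf i⟩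
    rintro a b ⟨σ, hσ, ha⟩ ⟨τ, hτ, hb⟩
    refine ⟨σ * τ, mul_mem hσ hτ, ?_⟩
    rw [mul_add, mul_assoc σ τ b, hb, mul_zero, add_zero,
      ← Subring.mem_center_iff.1 (hS hσ) τ, mul_assoc, ha, mul_zero]
end

section
/- Let {R_α}_{α∈A} be a finite family of ℂ-linear subspaces of M_n(ℂ), each closed under matrix multiplication, such that each R_α contains an element e_α which is a two-sided multiplicative identity for R_α (e_α·r = r·e_α = r for all r ∈ R_α). Fix a linear order on the index set A and assume: (1) e_{α₁} commutes with every element of R_{α₂} for all α₁, α₂ ∈ A; (2) e_{α₁}·R_{α₂} = e_{α₂}·R_{α₁} as subsets of M_n(ℂ), for all α₁, α₂; (3) e_{α₁}·e_{α₂} ∈ R_{α₁} for all α₁, α₂; (4) the inclusion–exclusion identity 1 = Σ_α e_α − Σ_{α₁<α₂} e_{α₁}e_{α₂} + Σ_{α₁<α₂<α₃} e_{α₁}e_{α₂}e_{α₃} − ⋯ + (−1)^{|A|+1} e_{α₁}⋯e_{α_{|A|}} holds in M_n(ℂ). Then the subspace R := Σ_{α∈A} R_α contains the identity matrix 1 and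 is closed under multiplication; that is, R is a unital ℂ-subalgebra of M_n(ℂ). -/
/-- A finite compatible family of "ring-subsets" `R_α` of `M_n(ℂ)` (each a
ℂ-subspace closed under multiplication with its own two-sided identity `e_α`),
satisfying conditions (1)-(4) (commutation, compatibility of the pieces, and the
inclusion–exclusion identity for the `e_α`'s), sums to a unital ℂ-subalgebra of
`M_n(ℂ)`: the subspace `R = Σ_α R_α` contains the identity matrix and is closed
under multiplication. -/
theorem sum_of_ring_subsets_is_unital_subalgebra
    {n : ℕ} {A : Type*} [Fintype A] [LinearOrder A]
    (R : A → Submodule ℂ (Matrix (Fin n) (Fin n) ℂ))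
    (e : A → Matrix (Fin n) (Fin n) ℂ)
    (hmulcl : ∀ α, ∀ x ∈ R α, ∀ y ∈ R α, x * y ∈ R α)
    (hmem : ∀ α, e α ∈ R α)
    (hident : ∀ α, ∀ r ∈ R α, e α * r = r ∧ r * e α = r)
    (h1 : ∀ α₁ α₂, ∀ r ∈ R α₂, e α₁ * r = r * e α₁)
    (h2 : ∀ α₁ α₂, (fun x => e α₁ * x) '' (R α₂ : Set (Matrix (Fin n) (Fin n) ℂ)) =
      (fun x => e α₂ * x) '' (R α₁ : Set (Matrix (Fin n) (Fin n) ℂ)))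
    (h3 : ∀ α₁ α₂, e α₁ * e α₂ ∈ R α₁)
    (h4 : (1 : Matrix (Fin n) (Fin n) ℂ) =
      ∑ T ∈ Finset.univ.powerset.filter (fun T : Finset A => T.Nonempty),
        ((-1 : ℂ) ^ (T.card + 1)) • ((T.sort (· ≤ ·)).map e).prod) :
    (1 : Matrix (Fin n) (Fin n) ℂ) ∈ (⨆ α, R α) ∧
    (∀ x ∈ (⨆ α, R α), ∀ y ∈ (⨆ α, R α), x * y ∈ (⨆ α, R α)) := by
  have hright : ∀ α, ∀ r ∈ R α, ∀ l : List A, r * (l.map e).prod ∈ R α := by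
    intro α r hr l
    induction l generalizing r with
    | nil => simpa using hr
    | cons β l ih =>
      have hβ : r * e β ∈ R α := by
        rw [← (hident α r hr).2, mul_assoc]
        exact hmulcl α _ hr _ (h3 α β)
      simpa [mul_assoc] using ih _ hβ
  have hmix : ∀ α β, ∀ x ∈ R α, ∀ y ∈ R β, x * y ∈ R α := by
    intro α β x hx y hy
    have hy' : e α * y ∈ (fun x => e β * x) '' (R α : Set (Matrix (Fin n) (Fin n) ℂ)) :=
      h2 α β ▸ Set.mem_image_of_mem _ hy
    obtain ⟨z, hz, hzy⟩ := hy'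
    have hey : e α * y = e α * e β * z := by
      rw [← h1 β α _ (hmem α), mul_assoc, (hident α z hz).1]
      exact hzy.symm
    rw [← (hident α x hx).2, mul_assoc, hey]
    exact hmulcl α _ hx _ (hmulcl α _ (h3 α β) _ hz)
  refine ⟨?_, fun x hx y hy => ?_⟩
  · rw [h4]
    refine Submodule.sum_mem _ fun T hT => Submodule.smul_mem _ _ ?_
    have hT : T.Nonempty := (Finset.mem_filter.mp hT).2
    rcases hl : T.sort (· ≤ ·) with _ | ⟨α, l⟩
    · have hcard := T.length_sort (· ≤ ·)
      rw [hl] at hcard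
      exact absurd hcard.symm hT.card_pos.ne'
    · rw [List.map_cons, List.prod_cons]
      exact Submodule.mem_iSup_of_mem α (hright α _ (hmem α) l)
  · induction hx using Submodule.iSup_induction' with
    | mem α x hx =>
      induction hy using Submodule.iSup_induction' with
      | mem β y hy => exact Submodule.mem_iSup_of_mem α (hmix α β x hx y hy)
      | zero => simp
      | add y₁ y₂ _ _ ih₁ ih₂ => simpa [mul_add] using add_mem ih₁ ih₂
    | zero => simp
    | add x₁ x₂ _ _ ih₁ ih₂ => simpa [add_mul] using add_mem ih₁ ih₂
end

section
/- Let {R_α}_{α∈A} be a finite family of ℂ-linear subspaces of M_n(ℂ), each closed under matrix multiplication with two-sided identity e_α ∈ R_α, satisfying conditions (1)–(4): (1) e_{α₁} commutes with every element of R_{α₂}; (2) e_{α₁}·R_{α₂} = e_{α₂}·R_{α₁}; (3) e_{α₁}·e_{α₂} ∈ R_{α₁}; (4) the inclusion–exclusion sum of the e_α's equals the identity matrix 1. Set R := Σ_{α∈A} R_α. Then for each α ∈ A: e_α lies in the center of R; e_α·R = R_α; R is the direct sum of ℂ-subspaces R = R_α ⊕ {r ∈ R : e_α·r = 0}; and the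 projection R → R_α, r ↦ e_α·r, is a surjective ring homomorphism carrying 1 to e_α. -/
/-- Under the hypotheses of the companion statement (a finite compatible family of
ring-subsets `R_α` of `M_n(ℂ)` with identities `e_α` satisfying (1)-(4), so that
`R = Σ_α R_α` is a unital subalgebra), for each `α`: `e_α` is central in `R`;
`e_α • R = R_α`; `R` decomposes as the direct sum of ℂ-subspaces
`R = R_α ⊕ {r ∈ R : e_α * r = 0}`; and `r ↦ e_α * r` is a surjective ring
homomorphism `R → R_α` carrying `1` to `e_α`. -/
theorem ring_subsets_give_central_covers
    {n : ℕ} {A : Type*} [Fintype A] [LinearOrder A]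
    (R : A → Submodule ℂ (Matrix (Fin n) (Fin n) ℂ))
    (e : A → Matrix (Fin n) (Fin n) ℂ)
    (hmulcl : ∀ α, ∀ x ∈ R α, ∀ y ∈ R α, x * y ∈ R α)
    (hmem : ∀ α, e α ∈ R α)
    (hident : ∀ α, ∀ r ∈ R α, e α * r = r ∧ r * e α = r)
    (h1 : ∀ α₁ α₂, ∀ r ∈ R α₂, e α₁ * r = r * e α₁)
    (h2 : ∀ α₁ α₂, (fun x => e α₁ * x) '' (R α₂ : Set (Matrix (Fin n) (Fin n) ℂ)) =
      (fun x => e α₂ * x) '' (R α₁ : Set (Matrix (Fin n) (Fin n) ℂ)))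
    (h3 : ∀ α₁ α₂, e α₁ * e α₂ ∈ R α₁)
    (h4 : (1 : Matrix (Fin n) (Fin n) ℂ) =
      ∑ T ∈ Finset.univ.powerset.filter (fun T : Finset A => T.Nonempty),
        ((-1 : ℂ) ^ (T.card + 1)) • ((T.sort (· ≤ ·)).map e).prod) :
    ∀ α : A,
      (∀ x ∈ (⨆ β, R β), e α * x = x * e α) ∧
      ((fun x => e α * x) '' ((⨆ β, R β : Submodule ℂ (Matrix (Fin n) (Fin n) ℂ)) :
          Set (Matrix (Fin n) (Fin n) ℂ)) = (R α : Set (Matrix (Fin n) (Fin n) ℂ))) ∧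
      (∀ r ∈ (⨆ β, R β),
        ∃! p : Matrix (Fin n) (Fin n) ℂ × Matrix (Fin n) (Fin n) ℂ,
          p.1 ∈ R α ∧ p.2 ∈ (⨆ β, R β) ∧ e α * p.2 = 0 ∧ r = p.1 + p.2) ∧
      (∀ x ∈ (⨆ β, R β), ∀ y ∈ (⨆ β, R β), e α * (x * y) = (e α * x) * (e α * y)) ∧
      e α * (1 : Matrix (Fin n) (Fin n) ℂ) = e α := by
  intro α
  have hle : ∀ {x}, x ∈ R α → x ∈ ⨆ β, R β := fun hx => Submodule.mem_iSup_of_mem α hx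
  have hcomm : ∀ x ∈ (⨆ β, R β), e α * x = x * e α := by
    intro x hx
    induction hx using Submodule.iSup_induction' with
    | mem β x hx => exact h1 α β x hx
    | zero => simp
    | add x y _ _ hx hy => rw [mul_add, add_mul, hx, hy]
  have hmaps : ∀ x ∈ (⨆ β, R β), e α * x ∈ R α := by
    intro x hx
    induction hx using Submodule.iSup_induction' with
    | mem β x hx =>
      have hmem_image : e α * x ∈ (fun x => e α * x) '' (R β : Set (Matrix (Fin n) (Fin n) ℂ)) :=
        ⟨x, hx, rfl⟩
      rw [h2 α β] at hmem_image
      obtain ⟨y, hy, hxy⟩ := hmem_image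
      have hfactor : e β * y = (e α * e β) * y := by
        rw [h1 α β (e β) (hmem β), mul_assoc, (hident α y hy).1]
      rw [← hxy]
      change e β * y ∈ R α
      rw [hfactor]
      exact hmulcl α _ (h3 α β) y hy
    | zero => simp
    | add x y _ _ hx hy => rw [mul_add]; exact add_mem hx hy
  refine ⟨hcomm, ?_, ?_, ?_, mul_one _⟩
  · apply Set.Subset.antisymm
    · rintro _ ⟨x, hx, rfl⟩
      exact hmaps x hx
    · intro x hx
      exact ⟨x, hle hx, (hident α x hx).1⟩
  · intro r hr
    refine ⟨(e α * r, r - e α * r),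
      ⟨hmaps r hr, sub_mem hr (hle (hmaps r hr)), ?_, (add_sub_cancel _ _).symm⟩, ?_⟩
    · change e α * (r - e α * r) = 0
      rw [mul_sub, (hident α _ (hmaps r hr)).1, sub_self]
    · rintro ⟨p, q⟩ ⟨hp, -, hq, hpq⟩
      dsimp only at hp hq hpq
      have hproj : e α * r = p := by rw [hpq, mul_add, hq, add_zero, (hident α p hp).1]
      rw [hproj, hpq, add_sub_cancel_left]
  · intro x hx y hy
    rw [← mul_assoc (e α * x), hcomm x hx, mul_assoc x (e α) (e α),
      (hident α _ (hmem α)).1, ← hcomm x hx, mul_assoc]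
end

section
/- Let m₁, m₂ ∈ M_n(ℂ), and equip M_n(ℂ) with its standard (Euclidean) topology. Then m₁ lies in the closure of the conjugation orbit {g·m₂·g⁻¹ : g ∈ GL_n(ℂ)} if and only if: the characteristic polynomials of m₁ and m₂ are equal, and for every λ ∈ ℂ and every natural number j one has rank((m₁ − λ·1)^j) ≤ rank((m₂ − λ·1)^j). -/
universe u

section LinearAlgebra

open Module

variable {K V V' : Type*} [Field K] [AddCommGroup V] [Module K V] [AddCommGroup V'] [Module K V']

/-- Two linear maps that agree on `U ⊓ W` can be glued along `U` and `W`. -/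
theorem LinearMap.exists_glue (U W : Submodule K V) (f h : V →ₗ[K] V')
    (hfh : ∀ x ∈ U, x ∈ W → f x = h x) :
    ∃ k : V →ₗ[K] V', (∀ x ∈ U, k x = f x) ∧ ∀ x ∈ W, k x = h x := by
  set a : W →ₗ[K] V ⧸ U := U.mkQ ∘ₗ W.subtype
  set b : W →ₗ[K] V' := (h - f) ∘ₗ W.subtype
  have hab : LinearMap.ker a ≤ LinearMap.ker b := by
    intro x hx
    have hxU : (x : V) ∈ U := by simpa [a] using hx
    simp [b, hfh x hxU x.2]
  obtain ⟨φ, hφ⟩ := LinearMap.exists_extend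
    ((LinearMap.ker a).liftQ b hab ∘ₗ a.quotKerEquivRange.symm.toLinearMap)
  refine ⟨f + φ ∘ₗ U.mkQ, fun x hx ↦ ?_, fun x hx ↦ ?_⟩
  · have : U.mkQ x = 0 := by simpa using hx
    simp only [LinearMap.add_apply, LinearMap.comp_apply, this, map_zero, add_zero]
  · have h1 : φ (U.mkQ x) = (LinearMap.ker a).liftQ b hab
        (a.quotKerEquivRange.symm ⟨a ⟨x, hx⟩, LinearMap.mem_range_self a _⟩) :=
      LinearMap.congr_fun hφ ⟨a ⟨x, hx⟩, LinearMap.mem_range_self a _⟩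
    have h2 : a.quotKerEquivRange.symm ⟨a ⟨x, hx⟩, LinearMap.mem_range_self a _⟩ =
        (LinearMap.ker a).mkQ ⟨x, hx⟩ := by
      rw [LinearEquiv.symm_apply_eq]; rfl
    have h3 : φ (U.mkQ x) = h x - f x := by
      rw [h1, h2]; rfl
    rw [LinearMap.add_apply, LinearMap.comp_apply, h3, add_sub_cancel]

theorem Submodule.exists_sup_eq_inf_eq_bot [FiniteDimensional K V] {P Q : Submodule K V}
    (hPQ : P ≤ Q) : ∃ C : Submodule K V, P ⊔ C = Q ∧ P ⊓ C = ⊥ ∧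
      finrank K P + finrank K C = finrank K Q := by
  obtain ⟨C, hC⟩ := exists_isCompl P
  have h1 : P ⊔ C ⊓ Q = Q := by rw [← sup_inf_assoc_of_le _ hPQ, hC.sup_eq_top, top_inf_eq]
  have h2 : P ⊓ (C ⊓ Q) = ⊥ := by rw [← inf_assoc, hC.inf_eq_bot, bot_inf_eq]
  have h3 := Submodule.finrank_sup_add_finrank_inf_eq P (C ⊓ Q)
  rw [h1, h2, finrank_bot] at h3
  exact ⟨C ⊓ Q, h1, h2, by omega⟩

/-- A linear map carrying `A` onto `A'` can be modified off `A` so that it carries `B ≥ A`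
onto `B' ≥ A'`, provided the dimensions agree. -/
theorem LinearMap.exists_eqOn_map_eq [FiniteDimensional K V] [FiniteDimensional K V']
    {A B : Submodule K V} {A' B' : Submodule K V'}
    (hAB : A ≤ B) (hAB' : A' ≤ B') (g : V →ₗ[K] V') (hg : A.map g = A')
    (hA : finrank K A = finrank K A') (hB : finrank K B = finrank K B') :
    ∃ k : V →ₗ[K] V', (∀ x ∈ A, k x = g x) ∧ B.map k = B' := by
  obtain ⟨C, hC, hAC, hfC⟩ := Submodule.exists_sup_eq_inf_eq_bot hAB
  obtain ⟨C', hC', -, hfC'⟩ := Submodule.exists_sup_eq_inf_eq_bot hAB'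
  have e : C ≃ₗ[K] C' := LinearEquiv.ofFinrankEq _ _ (by omega)
  obtain ⟨h, hh⟩ := LinearMap.exists_extend (C'.subtype ∘ₗ e.toLinearMap)
  obtain ⟨k, hkA, hkC⟩ := LinearMap.exists_glue A C g h fun x hxA hxC ↦ by
    have : x ∈ A ⊓ C := ⟨hxA, hxC⟩
    rw [hAC, Submodule.mem_bot] at this
    simp [this]
  have hmapA : A.map k = A' := by
    rw [← hg]
    exact SetLike.coe_injective (Set.image_congr hkA)
  have hmapC : C.map k = C' := by
    have h1 : C.map k = C.map h := SetLike.coe_injective (Set.image_congr hkC)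
    rw [h1, ← LinearMap.range_domRestrict]
    have h2 : h.domRestrict C = C'.subtype ∘ₗ e.toLinearMap := hh
    rw [h2, LinearMap.range_comp, LinearEquiv.range, Submodule.map_top, Submodule.range_subtype]
  exact ⟨k, hkA, by rw [← hC, Submodule.map_sup, hmapA, hmapC, hC']⟩

theorem Submodule.exists_le_le_finrank_eq [FiniteDimensional K V] {A B : Submodule K V}
    (hAB : A ≤ B) {c : ℕ} (hA : finrank K A ≤ c) (hB : c ≤ finrank K B) :
    ∃ C : Submodule K V, A ≤ C ∧ C ≤ B ∧ finrank K C = c := by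
  induction c, hA using Nat.le_induction with
  | base => exact ⟨A, le_rfl, hAB, rfl⟩
  | succ c hc ih =>
    obtain ⟨C, hAC, hCB, hCc⟩ := ih (by omega)
    obtain ⟨x, hxB, hxC⟩ : ∃ x ∈ B, x ∉ C := by
      by_contra! h
      have := Submodule.finrank_mono (show B ≤ C from h)
      omega
    refine ⟨C ⊔ K ∙ x, hAC.trans le_sup_left,
      sup_le hCB ((Submodule.span_singleton_le_iff_mem _ _).2 hxB), ?_⟩
    have hx0 : x ≠ 0 := fun h ↦ hxC (h ▸ C.zero_mem)
    have h1 := Submodule.finrank_sup_add_finrank_inf_eq C (K ∙ x)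
    rw [(Submodule.disjoint_span_singleton' hx0 |>.2 hxC).eq_bot, finrank_bot,
      finrank_span_singleton hx0] at h1
    omega

/-- In a finite decreasing chain of subspaces ending in `A`, there is a subspace of any
intermediate dimension comparable with every member of the chain. -/
theorem Submodule.exists_finrank_eq_comparable [FiniteDimensional K V] {A : Submodule K V}
    {C : ℕ → Submodule K V} (hC : Antitone C) (hA : ∀ i, A ≤ C i) {m : ℕ} (hm : C m = A)
    {c : ℕ} (hAc : finrank K A ≤ c) (hc : c ≤ finrank K (C 0)) :
    ∃ B : Submodule K V, A ≤ B ∧ B ≤ C 0 ∧ finrank K B = c ∧ ∀ i, C i ≤ B ∨ B ≤ C i := by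
  classical
  have hex : ∃ i, finrank K (C i) ≤ c := ⟨m, hm ▸ hAc⟩
  rcases hi : Nat.find hex with _ | i
  · have h0 := Nat.find_spec hex
    rw [hi] at h0
    exact ⟨C 0, hA 0, le_rfl, le_antisymm h0 hc, fun i ↦ .inl (hC (Nat.zero_le i))⟩
  · have h1 := Nat.find_spec hex
    have h2 := Nat.find_min hex (m := i) (by omega)
    rw [hi] at h1
    obtain ⟨B, h3, h4, h5⟩ := Submodule.exists_le_le_finrank_eq (hC (Nat.le_succ i)) h1
      (not_le.1 h2).le
    refine ⟨B, (hA _).trans h3, h4.trans (hC (Nat.zero_le i)), h5, fun k ↦ ?_⟩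
    rcases le_or_gt k i with hk | hk
    · exact .inr (h4.trans (hC hk))
    · exact .inl ((hC hk).trans h3)

theorem LinearMap.finrank_comap_eq [FiniteDimensional K V] (f : V →ₗ[K] V')
    (F : Submodule K V') :
    finrank K (F.comap f) = finrank K (LinearMap.ker f) +
      finrank K (LinearMap.range f ⊓ F : Submodule K V') := by
  rw [← LinearMap.finrank_range_add_finrank_ker (f.domRestrict (F.comap f)), add_comm,
    LinearMap.range_domRestrict, Submodule.map_comap_eq]
  congr 1
  rw [LinearMap.ker_domRestrict, ← LinearMap.finrank_range_of_inj
    (f := (F.comap f).subtype ∘ₗ (Submodule.subtype _)), LinearMap.range_comp,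
    Submodule.range_subtype,
    Submodule.map_comap_subtype, inf_eq_right.2]
  · exact LinearMap.ker_le_comap f
  · exact (Submodule.subtype_injective _).comp (Submodule.subtype_injective _)

theorem LinearMap.finrank_comap_add_finrank_le [FiniteDimensional K V] [FiniteDimensional K V']
    (f : V →ₗ[K] V') {F G : Submodule K V'} (hFG : F ≤ G) :
    finrank K (G.comap f) + finrank K F ≤ finrank K (F.comap f) + finrank K G := by
  rw [f.finrank_comap_eq, f.finrank_comap_eq]
  have h1 := Submodule.finrank_sup_add_finrank_inf_eq (LinearMap.range f ⊓ G) F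
  rw [inf_assoc, inf_eq_right.2 hFG] at h1
  have h2 := Submodule.finrank_mono (sup_le (inf_le_right : LinearMap.range f ⊓ G ≤ G) hFG)
  omega

theorem LinearMap.finrank_comap_add_finrank_eq [FiniteDimensional K V] [FiniteDimensional K V']
    (f : V →ₗ[K] V') {F G : Submodule K V'} (hFG : F ≤ G) (hG : G ≤ F ⊔ LinearMap.range f) :
    finrank K (G.comap f) + finrank K F = finrank K (F.comap f) + finrank K G := by
  rw [f.finrank_comap_eq, f.finrank_comap_eq]
  have h1 := Submodule.finrank_sup_add_finrank_inf_eq (LinearMap.range f ⊓ G) F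
  have h2 : LinearMap.range f ⊓ G ⊔ F = G := by
    rw [sup_comm, ← sup_inf_assoc_of_le _ hFG, inf_eq_right.2 hG]
  rw [inf_assoc, inf_eq_right.2 hFG, h2] at h1
  omega

end LinearAlgebra

section Conjugacy

open Module

variable {K : Type*} [Field K]

/-- An intertwining isomorphism between the ranges of two endomorphisms with kernels of equal
dimension extends to the whole spaces. -/
theorem LinearMap.exists_equiv_of_range_equiv {V V' : Type*} [AddCommGroup V] [Module K V]
    [AddCommGroup V'] [Module K V'] [FiniteDimensional K V] [FiniteDimensional K V']
    (N : End K V) (N' : End K V') (hV : finrank K V = finrank K V')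
    (hker : finrank K (LinearMap.ker N) = finrank K (LinearMap.ker N'))
    (g : LinearMap.range N ≃ₗ[K] LinearMap.range N')
    (hg : ∀ r : LinearMap.range N, (g ⟨N r, N.mem_range_self r⟩ : V') = N' (g r)) :
    ∃ e : V ≃ₗ[K] V', ∀ x, e (N x) = N' (e x) := by
  obtain ⟨g₀, hg₀⟩ := LinearMap.exists_extend ((LinearMap.range N').subtype ∘ₗ g.toLinearMap)
  have hg₀' : ∀ r : LinearMap.range N, g₀ r = g r := LinearMap.congr_fun hg₀
  have hg₀N : ∀ r ∈ LinearMap.range N, g₀ (N r) = N' (g₀ r) := fun r hr ↦ by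
    have h1 := hg ⟨r, hr⟩
    rw [← hg₀', ← hg₀'] at h1
    exact h1
  have hg₀inj : ∀ r ∈ LinearMap.range N, g₀ r = 0 → r = 0 := fun r hr h0 ↦ by
    have h1 : g ⟨r, hr⟩ = 0 := Subtype.ext ((hg₀' ⟨r, hr⟩).symm.trans h0)
    simpa using congrArg Subtype.val ((LinearEquiv.map_eq_zero_iff g).1 h1)
  obtain ⟨k, hkI, hkK⟩ := LinearMap.exists_eqOn_map_eq
    (A := LinearMap.ker N ⊓ LinearMap.range N) (B := LinearMap.ker N)
    (A' := (LinearMap.ker N ⊓ LinearMap.range N).map g₀) (B' := LinearMap.ker N')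
    inf_le_left (by
      rintro _ ⟨x, ⟨hx, hx'⟩, rfl⟩
      have h1 := hg₀N x hx'
      rw [LinearMap.mem_ker.1 hx, map_zero] at h1
      exact h1.symm) g₀ rfl (by
      rw [← LinearMap.range_domRestrict, LinearMap.finrank_range_of_inj]
      rw [← LinearMap.ker_eq_bot, LinearMap.ker_eq_bot']
      rintro ⟨x, hx⟩ h
      exact Subtype.ext (hg₀inj x hx.2 h)) hker
  have hkker : ∀ x ∈ LinearMap.ker N, N' (k x) = 0 := fun x hx ↦
    LinearMap.mem_ker.1 (hkK ▸ Submodule.mem_map_of_mem hx)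
  have hkinj : ∀ x ∈ LinearMap.ker N, k x = 0 → x = 0 := by
    have h1 := LinearMap.finrank_range_add_finrank_ker (k.domRestrict (LinearMap.ker N))
    rw [LinearMap.range_domRestrict, hkK, hker] at h1
    have h2 : LinearMap.ker (k.domRestrict (LinearMap.ker N)) = ⊥ :=
      Submodule.finrank_eq_zero.1 (by omega)
    intro x hx h0
    simpa using congrArg Subtype.val (LinearMap.ker_eq_bot'.1 h2 ⟨x, hx⟩ h0)
  obtain ⟨e₀, he₀K, he₀R⟩ := LinearMap.exists_glue (LinearMap.ker N) (LinearMap.range N) k g₀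
    fun x hx hx' ↦ hkI x ⟨hx, hx'⟩
  obtain ⟨s, hs⟩ := N'.rangeRestrict.exists_rightInverse_of_surjective N'.range_rangeRestrict
  have hsN : ∀ y : LinearMap.range N', N' (s y) = y := fun y ↦
    congrArg Subtype.val (LinearMap.congr_fun hs y)
  set g₁ : V →ₗ[K] V' := s ∘ₗ g.toLinearMap ∘ₗ N.rangeRestrict
  have hg₁ : ∀ x, N' (g₁ x) = g₀ (N x) := fun x ↦ by
    rw [hg₀' ⟨N x, N.mem_range_self x⟩]
    exact hsN _
  obtain ⟨T, hT⟩ := exists_isCompl (LinearMap.ker N ⊔ LinearMap.range N)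
  obtain ⟨e, heS, heT⟩ := LinearMap.exists_glue (LinearMap.ker N ⊔ LinearMap.range N) T e₀ g₁
    fun x hx hx' ↦ by
      have : x ∈ (LinearMap.ker N ⊔ LinearMap.range N) ⊓ T := ⟨hx, hx'⟩
      rw [hT.inf_eq_bot, Submodule.mem_bot] at this
      simp [this]
  have heK : ∀ x ∈ LinearMap.ker N, e x = k x := fun x hx ↦
    (heS x (Submodule.mem_sup_left hx)).trans (he₀K x hx)
  have heR : ∀ x ∈ LinearMap.range N, e x = g₀ x := fun x hx ↦
    (heS x (Submodule.mem_sup_right hx)).trans (he₀R x hx)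
  have heN : ∀ x, e (N x) = N' (e x) := by
    intro x
    rw [heR _ (N.mem_range_self x)]
    have hx : x ∈ LinearMap.ker N ⊔ LinearMap.range N ⊔ T := hT.sup_eq_top ▸ Submodule.mem_top
    obtain ⟨y, hy, t, ht, rfl⟩ := Submodule.mem_sup.1 hx
    obtain ⟨u, hu, v, hv, rfl⟩ := Submodule.mem_sup.1 hy
    simp only [map_add]
    rw [heK u hu, heR v hv, heT t ht, hkker u hu, hg₀N v hv, hg₁, LinearMap.mem_ker.1 hu, map_zero]
  have hinj : Function.Injective e := by
    rw [← LinearMap.ker_eq_bot, LinearMap.ker_eq_bot']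
    intro x hx
    have h1 : N x = 0 := hg₀inj _ (N.mem_range_self x) (by
      rw [← heR _ (N.mem_range_self x), heN, hx, map_zero])
    exact hkinj x h1 (by rw [← heK x h1, hx])
  exact ⟨e.linearEquivOfInjective hinj hV, heN⟩

theorem Module.End.genEigenspace_le_range_of_ne {V : Type*} [AddCommGroup V] [Module K V]
    [FiniteDimensional K V] (A : End K V) {lam μ : K} (h : μ ≠ lam) (j : ℕ) :
    A.genEigenspace μ j ≤ LinearMap.range (A - lam • 1) := by
  have hmaps : ∀ x ∈ A.genEigenspace μ j, (A - lam • 1) x ∈ A.genEigenspace μ j :=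
    A.mapsTo_genEigenspace_of_comm 
      ((Commute.refl A).sub_right ((Commute.one_right A).smul_right lam)) μ j
  have hinj : Function.Injective ((A - lam • 1).restrict hmaps) := by
    rw [← LinearMap.ker_eq_bot, LinearMap.ker_eq_bot']
    rintro ⟨x, hx⟩ h0
    have h1 : x ∈ A.genEigenspace lam 1 := by
      rw [Module.End.mem_genEigenspace_one]
      simpa [sub_eq_zero] using congrArg Subtype.val h0
    exact Subtype.ext ((Submodule.disjoint_def.1
      (A.disjoint_genEigenspace h j 1)) x hx h1)
  intro x hx
  obtain ⟨y, hy⟩ := (LinearMap.injective_iff_surjective.1 hinj) ⟨x, hx⟩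
  exact ⟨y, congrArg Subtype.val hy⟩

theorem Module.End.finrank_range_inf_genEigenspace {V : Type*} [AddCommGroup V] [Module K V]
    [FiniteDimensional K V] (A : End K V) (lam : K) (j : ℕ) :
    finrank K (A.genEigenspace lam (j + 1 : ℕ)) = finrank K (A.genEigenspace lam 1) +
      finrank K (LinearMap.range (A - lam • 1) ⊓ A.genEigenspace lam j : Submodule K V) := by
  have h1 := (A - lam • 1).finrank_comap_eq (A.genEigenspace lam j)
  rw [Module.End.genEigenspace_one, ← h1, Module.End.genEigenspace_nat,
    Module.End.genEigenspace_nat, pow_succ]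
  rfl

theorem Module.End.exists_equiv_of_finrank_genEigenspace_eq [IsAlgClosed K] (n : ℕ) :
    ∀ {V V' : Type u} [AddCommGroup V] [Module K V] [AddCommGroup V'] [Module K V']
    [FiniteDimensional K V] [FiniteDimensional K V'] (A : End K V) (B : End K V'),
    finrank K V = n → finrank K V' = n →
    (∀ (μ : K) (j : ℕ), finrank K (A.genEigenspace μ j) = finrank K (B.genEigenspace μ j)) →
    ∃ e : V ≃ₗ[K] V', ∀ x, e (A x) = B (e x) := by
  induction n using Nat.strong_induction_on with
  | _ n ih =>
  intro V V' _ _ _ _ _ _ A B hV hV' hAB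
  rcases Nat.eq_zero_or_pos n with rfl | hn
  · have := finrank_zero_iff.1 hV'
    exact ⟨LinearEquiv.ofFinrankEq _ _ (hV.trans hV'.symm), fun x ↦ Subsingleton.elim _ _⟩
  have : Nontrivial V := finrank_pos_iff.1 (hV ▸ hn)
  obtain ⟨lam, hlam⟩ := A.exists_eigenvalue
  have hinv : ∀ {W : Type u} [AddCommGroup W] [Module K W] (C : End K W),
      ∀ x ∈ LinearMap.range (C - lam • 1), C x ∈ LinearMap.range (C - lam • 1) := by
    rintro W _ _ C _ ⟨y, rfl⟩
    exact ⟨C y, by simp⟩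
  have hres : ∀ {W : Type u} [AddCommGroup W] [Module K W] [FiniteDimensional K W] (C : End K W)
      (μ : K) (j : ℕ), finrank K (Module.End.genEigenspace (LinearMap.restrict C (hinv C)) μ j) =
        finrank K (LinearMap.range (C - lam • 1) ⊓ C.genEigenspace μ j : Submodule K W) := by
    intro W _ _ _ C μ j
    rw [Submodule.inf_genEigenspace _ _ (hinv C)]
    exact (Submodule.finrank_map_subtype_eq _ _).symm
  have hker : finrank K (LinearMap.ker (A - lam • 1)) = finrank K (LinearMap.ker (B - lam • 1)) := by
    rw [← Module.End.genEigenspace_one, ← Module.End.genEigenspace_one]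
    exact_mod_cast hAB lam 1
  have hrA := LinearMap.finrank_range_add_finrank_ker (A - lam • 1)
  have hrB := LinearMap.finrank_range_add_finrank_ker (B - lam • 1)
  have hpos : 0 < finrank K (LinearMap.ker (A - lam • 1)) := by
    rw [← Module.End.genEigenspace_one]
    exact Submodule.one_le_finrank_iff.2 hlam
  obtain ⟨g, hg⟩ := ih (finrank K (LinearMap.range (A - lam • 1))) (by omega)
    (LinearMap.restrict A (hinv A)) (LinearMap.restrict B (hinv B)) rfl (by omega)
    fun μ j ↦ by
      rw [hres, hres]
      by_cases hμ : μ = lam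
      · subst hμ
        have h1 := A.finrank_range_inf_genEigenspace μ j
        have h2 := B.finrank_range_inf_genEigenspace μ j
        have h3 := hAB μ (j + 1)
        rw [Module.End.genEigenspace_one] at h1 h2
        omega
      · rw [inf_eq_right.2 (A.genEigenspace_le_range_of_ne hμ j),
          inf_eq_right.2 (B.genEigenspace_le_range_of_ne hμ j), hAB]
  obtain ⟨e, he⟩ := LinearMap.exists_equiv_of_range_equiv (A - lam • 1) (B - lam • 1)
    (hV.trans hV'.symm) hker g fun r ↦ by
      have h1 := congrArg Subtype.val (hg r)
      have h2 : (⟨(A - lam • 1) r, LinearMap.mem_range_self _ _⟩ : LinearMap.range (A - lam • 1)) =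
        LinearMap.restrict A (hinv A) r - lam • r := Subtype.ext (by simp)
      rw [h2, map_sub, map_smul]
      simp [h1]
  refine ⟨e, fun x ↦ ?_⟩
  simpa using he x

end Conjugacy

section Flags

open Module

variable {K V V' : Type*} [Field K] [AddCommGroup V] [Module K V] [AddCommGroup V'] [Module K V']

theorem LinearMap.exists_eqOn_of_iSupIndep {ι : Type*} {W : ι → Submodule K V}
    (hW : iSupIndep W) (hW' : ⨆ i, W i = ⊤) (g : ι → V →ₗ[K] V') :
    ∃ f : V →ₗ[K] V', ∀ i, ∀ x ∈ W i, f x = g i x := by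
  classical
  have hint := DirectSum.isInternal_submodule_of_iSupIndep_of_iSup_eq_top hW hW'
  let e := LinearEquiv.ofBijective (DirectSum.coeLinearMap W) hint
  refine ⟨DirectSum.toModule K ι V' (fun i ↦ g i ∘ₗ (W i).subtype) ∘ₗ e.symm.toLinearMap,
    fun i x hx ↦ ?_⟩
  have h1 : e.symm x = DirectSum.lof K ι (fun i ↦ W i) i ⟨x, hx⟩ := by
    rw [LinearEquiv.symm_apply_eq]
    exact (DirectSum.coeLinearMap_lof (R := K) W (i := i) ⟨x, hx⟩).symm
  simp [h1]

theorem Module.End.le_genEigenspace_of_flag (C : End K V) (lam : K) {F : ℕ → Submodule K V}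
    (h0 : F 0 = ⊥) (hF : ∀ j, F (j + 1) ≤ (F j).comap (C - lam • 1)) (j : ℕ) :
    F j ≤ C.genEigenspace lam j := by
  induction j with
  | zero => simp [h0]
  | succ j ih =>
    intro x hx
    have h1 := ih (hF j hx)
    rw [Module.End.mem_genEigenspace_nat, LinearMap.mem_ker] at h1 ⊢
    rw [pow_succ]
    exact h1

variable [FiniteDimensional K V] [FiniteDimensional K V']

theorem Module.End.exists_flag_step (N : End K V) (d : ℕ → ℕ) (hmono : Monotone d)
    (hconc : ∀ i j, d (i + j + 1) + d j ≤ d (i + j) + d (j + 1)) (j : ℕ) (F : Submodule K V)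
    (hker : F ≤ LinearMap.ker (N ^ j)) (hinv : F ≤ F.comap N) (hF : finrank K F = d j)
    (hdim : ∀ i, d (i + j) ≤ finrank K (F.comap (N ^ i))) :
    ∃ G : Submodule K V, F ≤ G ∧ G ≤ F.comap N ∧ finrank K G = d (j + 1) ∧
      ∀ i, d (i + (j + 1)) ≤ finrank K (G.comap (N ^ i)) := by
  set C : ℕ → Submodule K V := fun i ↦ F ⊔ (F.comap (N ^ (i + 1))).map (N ^ i) with hC
  have hC0 : C 0 = F.comap N := by
    simp only [hC, zero_add, pow_one, pow_zero, Module.End.one_eq_id, Submodule.map_id]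
    exact sup_eq_right.2 hinv
  have hanti : Antitone C := by
    refine antitone_nat_of_succ_le fun i ↦ sup_le_sup_left ?_ _
    rintro _ ⟨x, hx, rfl⟩
    refine ⟨N x, ?_, by rw [pow_succ]; rfl⟩
    have hx' : (N ^ (i + 1 + 1)) x ∈ F := hx
    rw [pow_succ] at hx'
    exact hx'
  have hend : C (finrank K V) = F := by
    refine sup_eq_left.2 ?_
    rintro _ ⟨x, hx, rfl⟩
    have h1 : (N ^ (j + (finrank K V + 1))) x = 0 := by
      rw [pow_add]
      exact hker hx
    have h2 : (N ^ finrank K V) x = 0 :=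
      Module.End.ker_pow_le_ker_pow_finrank N (j + (finrank K V + 1)) h1
    rw [h2]
    exact F.zero_mem
  obtain ⟨G, hFG, hGC, hG, hcomp⟩ := Submodule.exists_finrank_eq_comparable (c := d (j + 1)) hanti
    (fun i ↦ le_sup_left) hend (hF ▸ hmono (Nat.le_succ j)) (by
      have h1 := hdim 1
      rw [pow_one, add_comm] at h1
      rwa [hC0])
  refine ⟨G, hFG, hC0 ▸ hGC, hG, fun i ↦ ?_⟩
  rcases hcomp i with h | h
  · have h1 : F.comap (N ^ (i + 1)) ≤ G.comap (N ^ i) :=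
      Submodule.map_le_iff_le_comap.1 (le_sup_right.trans h)
    have h2 := Submodule.finrank_mono h1
    have h3 := hdim (i + 1)
    rw [show i + (j + 1) = i + 1 + j by ring]
    omega
  · have h1 := (N ^ i).finrank_comap_add_finrank_eq hFG
      (h.trans (sup_le_sup_left LinearMap.map_le_range _))
    have h2 := hconc i j
    have h3 := hdim i
    rw [← add_assoc]
    omega

/-- A concave dimension sequence bounded by the dimensions of the kernels `ker (N ^ j)` is
realized by a flag that `N` shifts down by one step. -/
theorem Module.End.exists_flag (N : End K V) (d : ℕ → ℕ) (h0 : d 0 = 0) (hmono : Monotone d)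
    (hconc : ∀ i j, d (i + j + 1) + d j ≤ d (i + j) + d (j + 1))
    (hd : ∀ j, d j ≤ finrank K (LinearMap.ker (N ^ j))) :
    ∃ F : ℕ → Submodule K V, F 0 = ⊥ ∧ Monotone F ∧ (∀ j, finrank K (F j) = d j) ∧
      ∀ j, F (j + 1) ≤ (F j).comap N := by
  let P : ℕ → Submodule K V → Prop := fun j F ↦ F ≤ LinearMap.ker (N ^ j) ∧ F ≤ F.comap N ∧
    finrank K F = d j ∧ ∀ i, d (i + j) ≤ finrank K (F.comap (N ^ i))
  have hstep : ∀ (j : ℕ) (F : {F // P j F}), ∃ G : {G // P (j + 1) G},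
      F.1 ≤ G.1 ∧ G.1 ≤ F.1.comap N := by
    rintro j ⟨F, hker, hinv, hF, hdim⟩
    obtain ⟨G, h1, h2, h3, h4⟩ := Module.End.exists_flag_step N d hmono hconc j F hker hinv hF hdim
    refine ⟨⟨G, fun x hx ↦ ?_, h2.trans (Submodule.comap_mono h1), h3, h4⟩, h1, h2⟩
    rw [LinearMap.mem_ker, pow_succ]
    exact hker (h2 hx)
  have hbase : P 0 ⊥ := ⟨bot_le, bot_le, by simp [h0], fun i ↦ hd i⟩
  choose next hnext using hstep
  let F : (j : ℕ) → {F // P j F} := fun j ↦ Nat.rec ⟨⊥, hbase⟩ next j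
  exact ⟨fun j ↦ (F j).1, rfl, monotone_nat_of_le_succ fun j ↦ (hnext j (F j)).1,
    fun j ↦ (F j).2.2.2.1, fun j ↦ (hnext j (F j)).2⟩

theorem Module.End.finrank_ker_pow_concave (N : End K V) (i j : ℕ) :
    finrank K (LinearMap.ker (N ^ (i + j + 1))) + finrank K (LinearMap.ker (N ^ j)) ≤
      finrank K (LinearMap.ker (N ^ (i + j))) + finrank K (LinearMap.ker (N ^ (j + 1))) := by
  have h : ∀ k, LinearMap.ker (N ^ (i + k)) = (LinearMap.ker (N ^ k)).comap (N ^ i) := fun k ↦ by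
    rw [add_comm, pow_add]; rfl
  rw [add_assoc, h, h]
  refine (N ^ i).finrank_comap_add_finrank_le fun x hx ↦ ?_
  rw [LinearMap.mem_ker] at hx ⊢
  rw [pow_succ', Module.End.mul_apply, hx, map_zero]

/-- Two flags with the same dimensions are related by a linear map. -/
theorem Submodule.exists_map_flag_eq {F : ℕ → Submodule K V} {F' : ℕ → Submodule K V'}
    (hF : Monotone F) (hF' : Monotone F') (h0 : F 0 = ⊥) (h0' : F' 0 = ⊥)
    (hdim : ∀ j, finrank K (F j) = finrank K (F' j)) :
    ∃ g : V →ₗ[K] V', ∀ j, (F j).map g = F' j := by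
  have hfin : ∀ m, ∃ g : V →ₗ[K] V', ∀ j ≤ m, (F j).map g = F' j := by
    intro m
    induction m with
    | zero => exact ⟨0, fun j hj ↦ by simp [Nat.le_zero.1 hj, h0, h0']⟩
    | succ m ih =>
      obtain ⟨g, hg⟩ := ih
      obtain ⟨k, hk, hk'⟩ := LinearMap.exists_eqOn_map_eq (hF (Nat.le_succ m)) (hF' (Nat.le_succ m))
        g (hg m le_rfl) (hdim m) (hdim (m + 1))
      refine ⟨k, fun j hj ↦ ?_⟩
      rcases Nat.le_succ_iff.1 hj with hj | rfl
      · rw [← hg j hj]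
        exact SetLike.coe_injective (Set.image_congr fun x hx ↦ hk x (hF hj hx))
      · exact hk'
  obtain ⟨a, ha⟩ := monotone_stabilizes_iff_noetherian.2 (inferInstance : IsNoetherian K V) ⟨F, hF⟩
  obtain ⟨b, hb⟩ := monotone_stabilizes_iff_noetherian.2 (inferInstance : IsNoetherian K V')
    ⟨F', hF'⟩
  obtain ⟨g, hg⟩ := hfin (max a b)
  refine ⟨g, fun j ↦ ?_⟩
  rcases le_total j (max a b) with hj | hj
  · exact hg j hj
  · have h1 : F a = F j := ha j ((le_max_left a b).trans hj)
    have h2 : F a = F (max a b) := ha _ (le_max_left a b)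
    have h3 : F' b = F' j := hb j ((le_max_right a b).trans hj)
    have h4 : F' b = F' (max a b) := hb _ (le_max_right a b)
    rw [← h1, ← h3, h2, h4, hg _ le_rfl]

/-- If `B` has the characteristic polynomial of `A` and smaller generalized eigenspaces, then some
conjugate of `B` and `A` shift down a common system of flags with the dimensions of the
generalized eigenspaces of `B`. -/
theorem Module.End.exists_common_flags [IsAlgClosed K] (A B : End K V)
    (hchar : A.charpoly = B.charpoly)
    (hAB : ∀ (lam : K) (j : ℕ),
      finrank K (B.genEigenspace lam j) ≤ finrank K (A.genEigenspace lam j)) :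
    ∃ (e : V ≃ₗ[K] V) (F : K → ℕ → Submodule K V), (⨆ lam, ⨆ j, F lam j) = ⊤ ∧
      (∀ lam, F lam 0 = ⊥) ∧
      (∀ lam (j : ℕ), finrank K (F lam j) = finrank K (B.genEigenspace lam j)) ∧
      (∀ lam j, F lam (j + 1) ≤ (F lam j).comap (A - lam • 1)) ∧
      ∀ lam j, F lam (j + 1) ≤ (F lam j).comap (e.conj B - lam • 1) := by
  have hmonoB : ∀ lam : K, Monotone fun j : ℕ ↦ B.genEigenspace lam (j : ℕ) := fun lam i j hij ↦
    (B.genEigenspace lam).monotone (by exact_mod_cast hij)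
  have hflag := fun lam : K ↦ (A - lam • 1).exists_flag
    (fun j ↦ finrank K (B.genEigenspace lam (j : ℕ))) (by simp)
    (fun i j hij ↦ Submodule.finrank_mono (hmonoB lam hij))
    (fun i j ↦ by
      have h1 := (B - lam • 1).finrank_ker_pow_concave i j
      rwa [← Module.End.genEigenspace_nat, ← Module.End.genEigenspace_nat,
        ← Module.End.genEigenspace_nat, ← Module.End.genEigenspace_nat] at h1)
    (fun j ↦ by
      rw [← Module.End.genEigenspace_nat]
      exact hAB lam j)
  choose F hF0 hFmono hFdim hFA using hflag
  have hFtop : ∀ lam, ⨆ j, F lam j = A.maxGenEigenspace lam := by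
    intro lam
    refine Submodule.eq_of_le_of_finrank_le (iSup_le fun j ↦
      (A.le_genEigenspace_of_flag lam (hF0 lam) (hFA lam) j).trans
        (A.genEigenspace_le_maximal lam j)) ?_
    rw [LinearMap.finrank_maxGenEigenspace_eq, hchar, ← LinearMap.finrank_maxGenEigenspace_eq,
      Module.End.maxGenEigenspace_eq_genEigenspace_finrank, ← hFdim]
    exact Submodule.finrank_mono (le_iSup (F lam) _)
  have htop : ⨆ lam, ⨆ j, F lam j = ⊤ := by
    simp_rw [hFtop]
    exact A.iSup_maxGenEigenspace_eq_top
  choose g hg using fun lam : K ↦ Submodule.exists_map_flag_eq (hmonoB lam) (hFmono lam)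
    (by simp) (hF0 lam) fun j ↦ (hFdim lam j).symm
  obtain ⟨f, hf⟩ := LinearMap.exists_eqOn_of_iSupIndep B.independent_maxGenEigenspace
    B.iSup_maxGenEigenspace_eq_top g
  have hfF : ∀ lam (j : ℕ), (B.genEigenspace lam j).map f = F lam j := fun lam j ↦ by
    rw [← hg]
    exact SetLike.coe_injective (Set.image_congr fun x hx ↦
      hf lam x (B.genEigenspace_le_maximal lam j hx))
  have hsurj : Function.Surjective f := by
    rw [← LinearMap.range_eq_top, eq_top_iff, ← htop]
    exact iSup_le fun lam ↦ iSup_le fun j ↦ hfF lam j ▸ LinearMap.map_le_range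
  refine ⟨LinearEquiv.ofBijective f ⟨LinearMap.injective_iff_surjective.2 hsurj, hsurj⟩, F, htop,
    hF0, hFdim, hFA, fun lam j ↦ ?_⟩
  rw [← hfF lam (j + 1)]
  rintro _ ⟨x, hx, rfl⟩
  rw [Submodule.mem_comap, ← hfF lam j]
  refine ⟨(B - lam • 1) x, ?_, ?_⟩
  · rw [SetLike.mem_coe, Module.End.mem_genEigenspace_nat, LinearMap.mem_ker] at hx ⊢
    rwa [pow_succ] at hx
  · set e := LinearEquiv.ofBijective f ⟨LinearMap.injective_iff_surjective.2 hsurj, hsurj⟩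
    have h1 : e.symm (f x) = x := e.symm_apply_apply x
    simp only [LinearMap.sub_apply, LinearEquiv.conj_apply, LinearMap.comp_apply,
      LinearEquiv.coe_coe, h1, map_sub]
    change f (B x) - f (lam • x) = f (B x) - lam • f x
    rw [map_smul]

end Flags

section MatrixOrbit

open Polynomial Module

theorem Matrix.rank_add_le {R m n : Type*} [Field R] [Fintype m] [Fintype n] (A B : Matrix m n R) :
    (A + B).rank ≤ A.rank + B.rank := by
  have h : LinearMap.range (A + B).mulVecLin ≤
      LinearMap.range A.mulVecLin ⊔ LinearMap.range B.mulVecLin := by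
    rw [Matrix.mulVecLin_add]
    exact LinearMap.range_add_le A.mulVecLin B.mulVecLin
  exact (Submodule.finrank_mono h).trans (Submodule.finrank_add_le_finrank_add_finrank _ _)

/-- The rank of a polynomial family of square matrices is lower semicontinuous for the cofinite
topology. -/
theorem Matrix.finite_rank_lt {R m : Type*} [Field R] [Fintype m] [DecidableEq m]
    (P : Matrix m m R[X]) (t₀ : R) :
    {t : R | ((evalRingHom t).mapMatrix P).rank < ((evalRingHom t₀).mapMatrix P).rank}.Finite := by
  obtain ⟨V, U, e, -, -, hVU⟩ := Matrix.exists_rank_normal_form ((evalRingHom t₀).mapMatrix P)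
  have hr : ((evalRingHom t₀).mapMatrix P).rank ≤ Fintype.card m := Matrix.rank_le_card_width _
  generalize ((evalRingHom t₀).mapMatrix P).rank = r at e hVU hr ⊢
  set Q : Matrix m m R := (Matrix.fromBlocks 0 0 0 1 :
    Matrix (Fin r ⊕ Fin (Fintype.card m - r)) (Fin r ⊕ Fin (Fintype.card m - r)) R).submatrix e e
  have hQ : Q.rank = Fintype.card m - r := by
    classical
    have h1 : (Matrix.fromBlocks 0 0 0 1 :
        Matrix (Fin r ⊕ Fin (Fintype.card m - r)) (Fin r ⊕ Fin (Fintype.card m - r)) R) =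
        Matrix.diagonal (Sum.elim 0 1) := by
      rw [← Matrix.fromBlocks_diagonal]
      simp
    rw [Matrix.rank_submatrix, h1, Matrix.rank_diagonal, Fintype.card_subtype]
    rw [Finset.card_filter, Fintype.sum_sum_type]
    simp
  set p : R[X] := ((C : R →+* R[X]).mapMatrix V * P * (C : R →+* R[X]).mapMatrix U +
    (C : R →+* R[X]).mapMatrix Q).det
  have hp : ∀ t, p.eval t = (V * (evalRingHom t).mapMatrix P * U + Q).det := by
    intro t
    have h1 : ∀ W : Matrix m m R, (evalRingHom t).mapMatrix ((C : R →+* R[X]).mapMatrix W) = W := by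
      intro W
      ext
      simp
    rw [← coe_evalRingHom, RingHom.map_det, map_add, map_mul, map_mul, h1, h1, h1]
  have hp0 : p ≠ 0 := by
    intro h0
    have h1 := hp t₀
    rw [hVU, h0, show (Matrix.fromBlocks 1 0 0 0).submatrix e e + Q = 1 by
      ext a b
      simp only [Matrix.one_apply, ← e.apply_eq_iff_eq (x := a)]
      cases ha : e a <;> cases hb : e b <;> simp [Q, ha, hb, Matrix.one_apply]] at h1
    simp at h1
  refine (finite_setOfPred_isRoot hp0).subset fun t ht ↦ ?_
  by_contra hroot
  have h1 : (V * (evalRingHom t).mapMatrix P * U + Q).det ≠ 0 := by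
    rw [← hp]
    exact hroot
  have h2 := Matrix.rank_of_det_ne_zero h1
  have h3 := Matrix.rank_add_le (V * (evalRingHom t).mapMatrix P * U) Q
  have h4 := (Matrix.rank_mul_le_left (V * (evalRingHom t).mapMatrix P) U).trans
    (Matrix.rank_mul_le_right V _)
  have h5 : ((evalRingHom t).mapMatrix P).rank < r := ht
  omega

theorem Matrix.rank_pow_add_finrank_genEigenspace {R : Type*} [Field R] {n : ℕ}
    (m : Matrix (Fin n) (Fin n) R) (lam : R) (j : ℕ) :
    ((m - lam • 1) ^ j).rank + finrank R (Module.End.genEigenspace (Matrix.toLin' m) lam j) = n := by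
  have h1 : Matrix.toLin' ((m - lam • 1) ^ j) = (Matrix.toLin' m - lam • 1) ^ j := by
    rw [Matrix.toLin'_pow, map_sub, map_smul, Matrix.toLin'_one]
    rfl
  rw [Module.End.genEigenspace_nat, ← h1, Matrix.rank, ← Matrix.toLin'_apply',
    LinearMap.finrank_range_add_finrank_ker]
  simp

theorem Matrix.isClosed_rank_le {n : ℕ} (lam : ℂ) (j r : ℕ) :
    IsClosed {m : Matrix (Fin n) (Fin n) ℂ | ((m - lam • 1) ^ j).rank ≤ r} := by
  have h1 := (isOpen_setOfPred_nat_le_rank (𝕜 := ℂ) (E := Fin n → ℂ) (F := Fin n → ℂ)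
    (r + 1)).isClosed_compl
  let L : Matrix (Fin n) (Fin n) ℂ →ₗ[ℂ] ((Fin n → ℂ) →L[ℂ] (Fin n → ℂ)) :=
    LinearMap.toContinuousLinearMap.toLinearMap ∘ₗ Matrix.toLin'.toLinearMap
  have hL : Continuous L := L.continuous_of_finiteDimensional
  have h2 : Continuous fun m : Matrix (Fin n) (Fin n) ℂ ↦ L ((m - lam • 1) ^ j) :=
    hL.comp (by fun_prop)
  convert h1.preimage h2 using 1
  ext m
  have h3 : ((L ((m - lam • 1) ^ j) : (Fin n → ℂ) →L[ℂ] (Fin n → ℂ)) :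
      (Fin n → ℂ) →ₗ[ℂ] (Fin n → ℂ)).rank = ((m - lam • 1) ^ j).rank := by
    rw [Matrix.rank, Module.finrank_eq_rank]
    rfl
  simp only [Set.mem_ofPred_eq, Set.mem_preimage, Set.mem_compl_iff, h3, Nat.cast_le]
  omega

theorem Matrix.isClosed_charpoly_eq {n : ℕ} (p : ℂ[X]) :
    IsClosed {m : Matrix (Fin n) (Fin n) ℂ | m.charpoly = p} := by
  have h1 : {m : Matrix (Fin n) (Fin n) ℂ | m.charpoly = p} =
      ⋂ t : ℂ, {m | (Matrix.scalar (Fin n) t - m).det = p.eval t} := by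
    ext m
    simp only [Set.mem_ofPred_eq, Set.mem_iInter, ← Matrix.eval_charpoly]
    exact ⟨fun h t ↦ by rw [h], fun h ↦ Polynomial.funext h⟩
  rw [h1]
  exact isClosed_iInter fun t ↦ isClosed_eq (by fun_prop) continuous_const

end MatrixOrbit

section Orbit

open Polynomial Module

theorem Matrix.exists_units_conj_of_equiv {R : Type*} [CommRing R] {n : ℕ}
    {m m' : Matrix (Fin n) (Fin n) R} (e : (Fin n → R) ≃ₗ[R] (Fin n → R))
    (h : ∀ x, e (Matrix.toLin' m x) = Matrix.toLin' m' (e x)) :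
    ∃ g : (Matrix (Fin n) (Fin n) R)ˣ,
      m' = (g : Matrix (Fin n) (Fin n) R) * m * (↑g⁻¹ : Matrix (Fin n) (Fin n) R) := by
  refine ⟨⟨LinearMap.toMatrix' e.toLinearMap, LinearMap.toMatrix' e.symm.toLinearMap, ?_, ?_⟩, ?_⟩
  · rw [← LinearMap.toMatrix'_comp]
    simp
  · rw [← LinearMap.toMatrix'_comp]
    simp
  · rw [Units.eq_mul_inv_iff_mul_eq]
    apply Matrix.toLin'.injective
    rw [Matrix.toLin'_mul, Matrix.toLin'_mul, Matrix.toLin'_toMatrix']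
    exact LinearMap.ext fun x ↦ (h x).symm

theorem Matrix.rank_pow_units_conj {R : Type*} [Field R] {n : ℕ}
    (g : (Matrix (Fin n) (Fin n) R)ˣ) (m : Matrix (Fin n) (Fin n) R) (lam : R) (j : ℕ) :
    ((((g : Matrix (Fin n) (Fin n) R) * m * (↑g⁻¹ : Matrix (Fin n) (Fin n) R)) -
      lam • 1) ^ j).rank = ((m - lam • 1) ^ j).rank := by
  have h : (g : Matrix (Fin n) (Fin n) R) * m * (↑g⁻¹ : Matrix (Fin n) (Fin n) R) - lam • 1 =
      g * (m - lam • 1) * (↑g⁻¹ : Matrix (Fin n) (Fin n) R) := by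
    simp [mul_sub, sub_mul]
  rw [h, Units.conj_pow, Matrix.rank_mul_eq_left_of_isUnit_det _ _
    ((Matrix.isUnit_iff_isUnit_det _).1 g⁻¹.isUnit), Matrix.rank_mul_eq_right_of_isUnit_det _ _
    ((Matrix.isUnit_iff_isUnit_det _).1 g.isUnit)]

/-- If a module is spanned by flags indexed by scalars, each of which is lowered by `C - lam`, then
a scalar whose flag vanishes is not an eigenvalue of `C`. -/
theorem Module.End.genEigenspace_eq_bot_of_flag {K V : Type*} [Field K] [AddCommGroup V]
    [Module K V] (C : Module.End K V) (F : K → ℕ → Submodule K V)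
    (htop : (⨆ lam, ⨆ j, F lam j) = ⊤) (h0 : ∀ lam, F lam 0 = ⊥)
    (hF : ∀ lam j, F lam (j + 1) ≤ (F lam j).comap (C - lam • (1 : Module.End K V)))
    (lam : K) (hlam : ∀ j, F lam j = ⊥) (j : ℕ) : C.genEigenspace lam j = ⊥ := by
  have h1 : (⨆ μ, ⨆ _ : μ ≠ lam, C.maxGenEigenspace μ) = ⊤ := by
    rw [eq_top_iff, ← htop]
    refine iSup_le fun μ ↦ iSup_le fun i ↦ ?_
    by_cases hμ : μ = lam
    · rw [hμ, hlam]
      exact bot_le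
    · refine le_trans ?_ (le_iSup₂_of_le μ hμ le_rfl)
      exact (Module.End.le_genEigenspace_of_flag C μ (h0 μ) (hF μ) i).trans
        ((C.genEigenspace μ).monotone le_top)
  have h2 := C.independent_maxGenEigenspace lam
  rw [h1, disjoint_top] at h2
  exact eq_bot_iff.2 (((C.genEigenspace lam).monotone le_top).trans h2.le)

theorem Matrix.mem_closure_units_conj {n : ℕ} {m₁ m₂ : Matrix (Fin n) (Fin n) ℂ}
    (hchar : m₁.charpoly = m₂.charpoly)
    (hrank : ∀ (lam : ℂ) (j : ℕ), ((m₁ - lam • 1) ^ j).rank ≤ ((m₂ - lam • 1) ^ j).rank) :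
    m₁ ∈ closure {x : Matrix (Fin n) (Fin n) ℂ | ∃ g : (Matrix (Fin n) (Fin n) ℂ)ˣ,
      x = (g : Matrix (Fin n) (Fin n) ℂ) * m₂ * (↑g⁻¹ : Matrix (Fin n) (Fin n) ℂ)} := by
  obtain ⟨e, F, htop, h0, hdim, hA, hB⟩ := Module.End.exists_common_flags
    (Matrix.toLin' m₁) (Matrix.toLin' m₂)
    (by rw [Matrix.charpoly_toLin', Matrix.charpoly_toLin', hchar]) (by
      intro lam j
      have h1 := Matrix.rank_pow_add_finrank_genEigenspace m₁ lam j
      have h2 := Matrix.rank_pow_add_finrank_genEigenspace m₂ lam j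
      have h3 := hrank lam j
      omega)
  set m₃ := LinearMap.toMatrix' (e.conj (Matrix.toLin' m₂)) with hm₃
  have hm₃' : Matrix.toLin' m₃ = e.conj (Matrix.toLin' m₂) := Matrix.toLin'_toMatrix' _
  obtain ⟨g, hg⟩ := Matrix.exists_units_conj_of_equiv (m := m₂) (m' := m₃) e fun x ↦ by
    rw [hm₃', LinearEquiv.conj_apply_apply, e.symm_apply_apply]
  set M : ℂ → Matrix (Fin n) (Fin n) ℂ := fun t ↦ m₁ + t • (m₃ - m₁) with hM
  have hflag : ∀ t lam j, F lam (j + 1) ≤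
      (F lam j).comap (Matrix.toLin' (M t) - lam • (1 : Module.End ℂ (Fin n → ℂ))) := by
    intro t lam j x hx
    have h1 := hA lam j hx
    have h2 := hB lam j hx
    rw [Submodule.mem_comap] at h1 h2 ⊢
    have h3 : (Matrix.toLin' (M t) - lam • (1 : Module.End ℂ (Fin n → ℂ))) x =
        (1 - t) • (Matrix.toLin' m₁ - lam • (1 : Module.End ℂ (Fin n → ℂ))) x +
        t • (e.conj (Matrix.toLin' m₂) - lam • (1 : Module.End ℂ (Fin n → ℂ))) x := by
      rw [← hm₃', hM]
      simp only [map_add, map_smul, map_sub, LinearMap.sub_apply, LinearMap.add_apply,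
        LinearMap.smul_apply, Module.End.one_apply]
      module
    rw [h3]
    exact add_mem (Submodule.smul_mem _ _ h1) (Submodule.smul_mem _ _ h2)
  set bad : Set ℂ := ⋃ lam ∈ {lam | Module.End.HasEigenvalue (Matrix.toLin' m₂) lam}, ⋃ j : ℕ,
    {t | ((M t - lam • 1) ^ j).rank < ((m₂ - lam • 1) ^ j).rank} with hbad
  have hcount : bad.Countable := by
    refine (Module.End.finite_hasEigenvalue _).countable.biUnion fun lam _ ↦
      Set.countable_iUnion fun j ↦ Set.Finite.countable ?_
    have h := Matrix.finite_rank_lt (((C : ℂ →+* ℂ[X]).mapMatrix (m₁ - lam • 1) +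
      (X : ℂ[X]) • (C : ℂ →+* ℂ[X]).mapMatrix (m₃ - m₁)) ^ j) 1
    have hev : ∀ t, (evalRingHom t).mapMatrix (((C : ℂ →+* ℂ[X]).mapMatrix (m₁ - lam • 1) +
        (X : ℂ[X]) • (C : ℂ →+* ℂ[X]).mapMatrix (m₃ - m₁)) ^ j) = (M t - lam • 1) ^ j := by
      intro t
      rw [map_pow]
      congr 1
      ext a b
      simp [hM]
      ring
    simp only [hev] at h
    have h1 : M 1 = m₃ := by simp [hM]
    rwa [h1, hg, Matrix.rank_pow_units_conj] at h
  have hgood : ∀ t, t ∉ bad → ∃ g : (Matrix (Fin n) (Fin n) ℂ)ˣ,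
      M t = (g : Matrix (Fin n) (Fin n) ℂ) * m₂ * (↑g⁻¹ : Matrix (Fin n) (Fin n) ℂ) := by
    intro t ht
    have hn : finrank ℂ (Fin n → ℂ) = n := by simp
    obtain ⟨e', he'⟩ := Module.End.exists_equiv_of_finrank_genEigenspace_eq n
      (Matrix.toLin' m₂) (Matrix.toLin' (M t)) hn hn (by
        intro lam j
        by_cases hlam : Module.End.HasEigenvalue (Matrix.toLin' m₂) lam
        · have h1 : ¬ ((M t - lam • 1) ^ j).rank < ((m₂ - lam • 1) ^ j).rank := fun h ↦
            ht (Set.mem_biUnion hlam (Set.mem_iUnion_of_mem j h))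
          have h2 := Matrix.rank_pow_add_finrank_genEigenspace m₂ lam j
          have h3 := Matrix.rank_pow_add_finrank_genEigenspace (M t) lam j
          have h4 := Submodule.finrank_mono
            (Module.End.le_genEigenspace_of_flag _ lam (h0 lam) (hflag t lam) j)
          rw [hdim] at h4
          omega
        · have h1 : ∀ i : ℕ, Module.End.genEigenspace (Matrix.toLin' m₂) lam i = ⊥ := by
            intro i
            by_contra h
            exact hlam (Module.End.HasUnifEigenvalue.lt zero_lt_one h)
          rw [h1, Module.End.genEigenspace_eq_bot_of_flag _ F htop h0 (hflag t) lam (fun i ↦ by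
            rw [← Submodule.finrank_eq_zero (R := ℂ), hdim, h1, finrank_bot])])
    exact Matrix.exists_units_conj_of_equiv e' he'
  have hcont : Continuous M := by fun_prop
  have hM0 : M 0 = m₁ := by simp [hM]
  rw [← hM0]
  exact map_mem_closure hcont (hcount.dense_compl ℂ 0) hgood

end Orbit

/-- Closure of conjugation orbits in `M_n(ℂ)` (standard topology): `m₁` lies in the
closure of the `GL_n(ℂ)`-conjugation orbit of `m₂` if and only if they have equal
characteristic polynomials and `rank((m₁ - λ)^j) ≤ rank((m₂ - λ)^j)` for every
`λ ∈ ℂ` and every `j ∈ ℕ`. -/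
theorem mem_closure_conjugation_orbit_iff
    {n : ℕ} (m₁ m₂ : Matrix (Fin n) (Fin n) ℂ) :
    m₁ ∈ closure {x : Matrix (Fin n) (Fin n) ℂ |
        ∃ g : (Matrix (Fin n) (Fin n) ℂ)ˣ,
          x = (g : Matrix (Fin n) (Fin n) ℂ) * m₂ * ((g⁻¹ : (Matrix (Fin n) (Fin n) ℂ)ˣ) :
            Matrix (Fin n) (Fin n) ℂ)} ↔
      (m₁.charpoly = m₂.charpoly ∧
        ∀ (lam : ℂ) (j : ℕ),
          ((m₁ - lam • 1) ^ j).rank ≤ ((m₂ - lam • 1) ^ j).rank) := by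
  constructor
  · intro h
    have hchar : m₁ ∈ {m : Matrix (Fin n) (Fin n) ℂ | m.charpoly = m₂.charpoly} := by
      refine closure_minimal ?_ (Matrix.isClosed_charpoly_eq _) h
      rintro _ ⟨g, rfl⟩
      rw [Set.mem_ofPred_eq, Matrix.coe_units_inv, Matrix.charpoly_units_conj]
    refine ⟨hchar, fun lam j ↦ ?_⟩
    refine closure_minimal ?_ (Matrix.isClosed_rank_le lam j _) h
    rintro _ ⟨g, rfl⟩
    exact (Matrix.rank_pow_units_conj g m₂ lam j).le
  · rintro ⟨hchar, hrank⟩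
    exact Matrix.mem_closure_units_conj hchar hrank
end

section
/- Equip M_n(ℂ) × M_n(ℂ) with the standard (Euclidean) topology. Then the set of pairs (a, b) of commuting matrices that are simultaneously diagonalizable with each of a and b having n pairwise distinct eigenvalues (i.e., there exists g ∈ GL_n(ℂ) such that g·a·g⁻¹ and g·b·g⁻¹ are both diagonal, each with pairwise distinct diagonal entries) is dense in the commuting variety {(m₁, m₂) ∈ M_n(ℂ) × M_n(ℂ) : m₁·m₂ = m₂·m₁}. Equivalently, every pair of commuting complex n×n matrices is a limit of pairs of simultaneously diagonalizable commuting matrices with distinct eigenvalues. -/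
open Polynomial Matrix Topology Filter

/-- The pairs of complex matrices that a single change of basis makes diagonal, each with
pairwise distinct diagonal entries. -/
def simpleSpectrumDiagonalizablePairs (n : ℕ) :
    Set (Matrix (Fin n) (Fin n) ℂ × Matrix (Fin n) (Fin n) ℂ) :=
  {p | ∃ g : (Matrix (Fin n) (Fin n) ℂ)ˣ, ∃ a b : Fin n → ℂ,
    Function.Injective a ∧ Function.Injective b ∧
    (g : Matrix (Fin n) (Fin n) ℂ) * p.1 *
      ((g⁻¹ : (Matrix (Fin n) (Fin n) ℂ)ˣ) : Matrix (Fin n) (Fin n) ℂ) = Matrix.diagonal a ∧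
    (g : Matrix (Fin n) (Fin n) ℂ) * p.2 *
      ((g⁻¹ : (Matrix (Fin n) (Fin n) ℂ)ˣ) : Matrix (Fin n) (Fin n) ℂ) = Matrix.diagonal b}

/-- A continuous curve that lies in `s` off the zero set of a nonzero polynomial stays in the
closure of `s`. -/
theorem mem_closure_of_eval_ne_zero {X : Type*} [TopologicalSpace X] {s : Set X} {F : ℂ → X}
    (hF : Continuous F) {P : ℂ[X]} (hP : P ≠ 0) (h : ∀ t, P.eval t ≠ 0 → F t ∈ s) (t₀ : ℂ) :
    F t₀ ∈ closure s := by
  refine mem_closure_of_tendsto (hF.continuousAt.tendsto.mono_left nhdsWithin_le_nhds)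
    (b := 𝓝[≠] t₀) (Eventually.mono ?_ h)
  refine nhdsNE_le_cofinite t₀ (eventually_cofinite.2 ?_)
  refine (P.roots.toFinset.finite_toSet).subset fun t ht => ?_
  simpa [hP] using ht

theorem aeval_conj_diagonal {n : ℕ} (g : (Matrix (Fin n) (Fin n) ℂ)ˣ)
    {A : Matrix (Fin n) (Fin n) ℂ} {a : Fin n → ℂ}
    (h : (g : Matrix (Fin n) (Fin n) ℂ) * A *
      ((g⁻¹ : (Matrix (Fin n) (Fin n) ℂ)ˣ) : Matrix (Fin n) (Fin n) ℂ) = diagonal a) (p : ℂ[X]) :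
    (g : Matrix (Fin n) (Fin n) ℂ) * aeval A p *
      ((g⁻¹ : (Matrix (Fin n) (Fin n) ℂ)ˣ) : Matrix (Fin n) (Fin n) ℂ) =
        diagonal fun i => p.eval (a i) := by
  induction p using Polynomial.induction_on' with
  | add p q hp hq =>
    rw [map_add, mul_add, add_mul, hp, hq, diagonal_add]
    simp
  | monomial k c =>
    rw [aeval_monomial, ← Algebra.smul_def, mul_smul_comm, smul_mul_assoc, ← Units.conj_pow, h,
      diagonal_pow, ← diagonal_smul]
    congr 1
    ext i
    simp

/-- A matrix with separable characteristic polynomial is diagonalizable with distinct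
eigenvalues. -/
theorem exists_conj_eq_diagonal_of_separable {n : ℕ} {A : Matrix (Fin n) (Fin n) ℂ}
    (hA : A.charpoly.Separable) :
    ∃ g : (Matrix (Fin n) (Fin n) ℂ)ˣ, ∃ a : Fin n → ℂ, Function.Injective a ∧
      (g : Matrix (Fin n) (Fin n) ℂ) * A *
        ((g⁻¹ : (Matrix (Fin n) (Fin n) ℂ)ˣ) : Matrix (Fin n) (Fin n) ℂ) = diagonal a := by
  have hcard : A.charpoly.roots.toFinset.card = n := by
    rw [Multiset.toFinset_card_of_nodup (nodup_roots hA), IsAlgClosed.card_roots_eq_natDegree,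
      charpoly_natDegree_eq_dim, Fintype.card_fin]
  let σ := (A.charpoly.roots.toFinset.equivFinOfCardEq hcard).symm
  let a : Fin n → ℂ := fun i => σ i
  have ha : Function.Injective a := Subtype.val_injective.comp σ.injective
  have hev (i : Fin n) : Module.End.HasEigenvalue (toLin' A) (a i) := by
    rw [Module.End.hasEigenvalue_iff_isRoot_charpoly, charpoly_toLin']
    exact isRoot_of_mem_roots (Multiset.mem_toFinset.1 (σ i).2)
  choose v hv using fun i => (hev i).exists_hasEigenvector
  have hli := Module.End.eigenvectors_linearIndependent' (toLin' A) a ha v hv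
  let Q : Matrix (Fin n) (Fin n) ℂ := (Matrix.of v)ᵀ
  have hQ : IsUnit Q := linearIndependent_cols_iff_isUnit.1 hli
  obtain ⟨u, hu⟩ := hQ
  refine ⟨u⁻¹, a, ha, ?_⟩
  have hAQ : A * Q = Q * diagonal a := by
    ext i j
    rw [mul_diagonal]
    simpa [Q, Matrix.mul_apply, mulVec, dotProduct, mul_comm] using
      congrFun (hv j).apply_eq_smul i
  rw [inv_inv, mul_assoc, hu, hAQ, ← hu, Units.inv_mul_cancel_left]

theorem closure_separable_charpoly {n : ℕ} (A : Matrix (Fin n) (Fin n) ℂ) :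
    A ∈ closure {M : Matrix (Fin n) (Fin n) ℂ | M.charpoly.Separable} := by
  let D : Matrix (Fin n) (Fin n) ℂ := diagonal fun i => ((i : ℕ) : ℂ)
  let N : Matrix (Fin n) (Fin n) ℂ[X] := A.map C + (X : ℂ[X]) • (D - A).map C
  let P : ℂ[X] := N.charpoly.resultant (derivative N.charpoly) n (n - 1)
  have hN (t : ℂ) : N.map (evalRingHom t) = A + t • (D - A) := by
    ext i j
    simp [N]
  have hP (t : ℂ) : P.eval t ≠ 0 ↔ (A + t • (D - A)).charpoly.Separable := by
    have hdeg : (A + t • (D - A)).charpoly.natDegree = n := by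
      rw [charpoly_natDegree_eq_dim, Fintype.card_fin]
    have key := isUnit_resultant_iff_isCoprime (g := derivative (A + t • (D - A)).charpoly)
      (charpoly_monic (A + t • (D - A)))
    rw [natDegree_derivative, hdeg, isUnit_iff_ne_zero] at key
    rw [Separable, ← key, ← hN, charpoly_map, derivative_map, resultant_map_map]
    rfl
  have hP0 : P ≠ 0 := by
    intro h0
    refine (hP 1).2 ?_ (by simp [h0])
    rw [one_smul, add_sub_cancel, charpoly_diagonal, separable_prod_X_sub_C_iff]
    exact fun i j hij => Fin.ext (Nat.cast_injective hij)
  simpa using mem_closure_of_eval_ne_zero (F := fun t => A + t • (D - A)) (by fun_prop) hP0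
    (fun t => (hP t).1) 0

theorem mem_closure_of_separable {n : ℕ} {A : Matrix (Fin n) (Fin n) ℂ}
    (hA : A.charpoly.Separable) (p : ℂ[X]) :
    (A, aeval A p) ∈ closure (simpleSpectrumDiagonalizablePairs n) := by
  obtain ⟨g, a, ha, hg⟩ := exists_conj_eq_diagonal_of_separable hA
  let P : ℂ[X] := ∏ ij ∈ (Finset.univ : Finset (Fin n)).offDiag,
    (C (p.eval (a ij.1) - p.eval (a ij.2)) + C (a ij.1 - a ij.2) * X)
  have hP0 : P ≠ 0 := by
    refine Finset.prod_ne_zero_iff.2 fun ij hij h0 => ?_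
    have h1 := congrArg (fun q : ℂ[X] => q.coeff 1) h0
    simp only [coeff_add, coeff_C_mul, coeff_X_one, coeff_C_succ, coeff_zero, mul_one,
      zero_add] at h1
    exact (Finset.mem_offDiag.1 hij).2.2 (ha (sub_eq_zero.1 h1))
  have hmem := mem_closure_of_eval_ne_zero (F := fun t : ℂ => (A, aeval A p + t • A))
    (s := simpleSpectrumDiagonalizablePairs n) (by fun_prop) hP0 (fun t ht => ?_) 0
  · simpa using hmem
  · have hb := aeval_conj_diagonal g hg (p + C t * X)
    refine ⟨g, a, _, ha, fun i j hij => ?_, hg, by simpa [Algebra.smul_def] using hb⟩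
    by_contra hne
    rw [eval_prod] at ht
    refine Finset.prod_ne_zero_iff.1 ht (i, j) (by simpa using hne) ?_
    simp at hij ⊢
    linear_combination hij

theorem mem_closure_aeval {n : ℕ} (A : Matrix (Fin n) (Fin n) ℂ) (p : ℂ[X]) :
    (A, aeval A p) ∈ closure (simpleSpectrumDiagonalizablePairs n) := by
  have hc : Continuous fun M : Matrix (Fin n) (Fin n) ℂ => (M, aeval M p) :=
    continuous_id.prodMk (p.continuous_aeval)
  rw [← closure_closure (s := simpleSpectrumDiagonalizablePairs n)]
  exact map_mem_closure (f := fun M => (M, aeval M p)) hc (closure_separable_charpoly A)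
    fun M hM => mem_closure_of_separable hM p

/-- The matrix with columns `v, A v, …, A ^ (n - 1) v`. -/
def krylov {R : Type*} [CommRing R] {n : ℕ} (A : Matrix (Fin n) (Fin n) R) (v : Fin n → R) :
    Matrix (Fin n) (Fin n) R :=
  Matrix.of fun i j => (A ^ (j : ℕ) *ᵥ v) i

theorem krylov_map {R S : Type*} [CommRing R] [CommRing S] (φ : R →+* S) {n : ℕ}
    (A : Matrix (Fin n) (Fin n) R) (v : Fin n → R) :
    (krylov A v).map φ = krylov (A.map φ) (φ ∘ v) := by
  ext i j
  simp only [krylov, map_apply, of_apply, RingHom.map_mulVec, Matrix.map_pow]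

theorem krylov_mulVec {R : Type*} [CommRing R] {n : ℕ} (A : Matrix (Fin n) (Fin n) R)
    (v c : Fin n → R) :
    krylov A v *ᵥ c = aeval A (∑ j : Fin n, C (c j) * X ^ (j : ℕ)) *ᵥ v := by
  have h : krylov A v *ᵥ c = ∑ j : Fin n, c j • (A ^ (j : ℕ) *ᵥ v) := by
    ext i
    simp [krylov, mulVec, dotProduct, mul_comm]
  simp [h, sum_mulVec, ← Algebra.smul_def, smul_mulVec]

theorem isUnit_krylov {n : ℕ} {A : Matrix (Fin n) (Fin n) ℂ} {v : Fin n → ℂ}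
    (h : ∀ w, ∃ q : ℂ[X], aeval A q *ᵥ v = w) : IsUnit (krylov A v) := by
  rw [← mulVec_surjective_iff_isUnit]
  intro w
  obtain ⟨q, rfl⟩ := h w
  have hdeg : (q %ₘ A.charpoly).degree < n := by
    have := degree_modByMonic_lt q A.charpoly_monic
    rwa [charpoly_degree_eq_dim, Fintype.card_fin] at this
  refine ⟨fun j => (q %ₘ A.charpoly).coeff j, ?_⟩
  rw [krylov_mulVec, sum_fin (fun j a => C a * X ^ j) (by simp) hdeg, sum_C_mul_X_pow_eq]
  conv_rhs => rw [← modByMonic_add_div q A.charpoly]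
  simp [aeval_self_charpoly]

/-- The commutant of a cyclic matrix consists of polynomials in that matrix. -/
theorem exists_aeval_eq_of_isUnit_krylov {R : Type*} [CommRing R] {n : ℕ}
    {A B : Matrix (Fin n) (Fin n) R} {v : Fin n → R}
    (h : IsUnit (krylov A v)) (hAB : Commute A B) : ∃ p : R[X], aeval A p = B := by
  obtain ⟨c, hc⟩ := mulVec_surjective_iff_isUnit.2 h (B *ᵥ v)
  rw [krylov_mulVec] at hc
  set p : R[X] := ∑ j : Fin n, C (c j) * X ^ (j : ℕ)
  refine ⟨p, h.mul_right_cancel ?_⟩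
  have hmul (M : Matrix (Fin n) (Fin n) R) (hM : Commute A M) :
      M * krylov A v = Matrix.of fun i (j : Fin n) => (A ^ (j : ℕ) *ᵥ (M *ᵥ v)) i := by
    ext i j
    rw [of_apply, mulVec_mulVec, (hM.pow_left _).eq, ← mulVec_mulVec]
    rfl
  rw [hmul B hAB, hmul _ ?_, hc]
  simpa using ((commute_X p).map (aeval A : R[X] →ₐ[R] _))

/-- Over `ℂ`, every endomorphism commutes with a cyclic one: shift the eigenvalue of each cyclic
summand so that these become distinct. -/
theorem exists_commute_cyclic {V : Type*} [AddCommGroup V] [Module ℂ V] [FiniteDimensional ℂ V]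
    (f : Module.End ℂ V) :
    ∃ r : Module.End ℂ V, Commute f r ∧ ∃ v, ∀ w, ∃ q : ℂ[X], aeval r q v = w := by
  obtain ⟨ι, _, p, hp, e, ⟨φ⟩⟩ := Module.equiv_directSum_of_isTorsion
    (Module.AEval.isTorsion_of_finiteDimensional ℂ V f)
  let I (i : ι) : Ideal ℂ[X] := Ideal.span {p i ^ e i}
  let Q := ∀ i, ℂ[X] ⧸ I i
  classical
  let φ' : Module.AEval' f ≃ₗ[ℂ[X]] Q :=
    φ.trans (DirectSum.linearEquivFunOnFintype ℂ[X] ι fun i => ℂ[X] ⧸ I i)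
  let ψ : V ≃ₗ[ℂ] Q := (Module.AEval'.of f).trans (φ'.restrictScalars ℂ)
  have hψ (x : V) : ψ (f x) = (X : ℂ[X]) • ψ x := by
    change φ' (Module.AEval'.of f (f x)) = (X : ℂ[X]) • φ' (Module.AEval'.of f x)
    rw [← map_smul, Module.AEval'.X_smul_of]
  have hroot (i : ι) : ∃ l : ℂ, p i ∣ X - C l := by
    obtain ⟨l, hl⟩ := IsAlgClosed.exists_root (p i)
      (by rw [IsAlgClosed.degree_eq_one_of_irreducible ℂ (hp i)]; exact one_ne_zero)
    exact ⟨l, (irreducible_X_sub_C l).dvd_symm (hp i) (dvd_iff_isRoot.2 hl)⟩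
  choose l hl using hroot
  let s (i : ι) : ℂ := (Fintype.equivFin ι i : ℕ)
  have hs : Function.Injective s :=
    Nat.cast_injective.comp (Fin.val_injective.comp (Fintype.equivFin ι).injective)
  let y : Q := fun i => Ideal.Quotient.mk (I i) (X + C (s i - l i))
  have haeval (q : ℂ[X]) (i : ι) :
      aeval y q i = Ideal.Quotient.mk (I i) (q.comp (X + C (s i - l i))) := by
    have h1 : aeval y q i = aeval (y i) q :=
      (aeval_algHom_apply (Pi.evalAlgHom ℂ (fun i => ℂ[X] ⧸ I i) i) y q).symm
    have h2 := aeval_algHom_apply (Ideal.Quotient.mkₐ ℂ (I i)) (X + C (s i - l i)) q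
    rw [h1]
    exact h2
  let ρ : Module.End ℂ Q := Algebra.lmul ℂ Q y
  refine ⟨ψ.symm.conjAlgEquiv ℂ ρ, ?_, ψ.symm 1, fun w => ?_⟩
  · ext x
    apply ψ.injective
    simp only [Module.End.mul_apply, hψ]
    simp [hψ, ρ, LinearEquiv.conjAlgEquiv_apply, mul_smul_comm]
  · have hco : Pairwise (Function.onFun IsCoprime fun i => Ideal.span {(X - C (s i)) ^ e i}) :=
      fun i j hij => (Ideal.isCoprime_span_singleton_iff _ _).2
        ((pairwise_coprime_X_sub_C hs hij).pow)
    choose z hz using fun i => Ideal.Quotient.mk_surjective (ψ w i)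
    obtain ⟨q, hq⟩ := Ideal.exists_forall_sub_mem_ideal hco
      fun i => (z i).comp (X - C (s i - l i))
    refine ⟨q, ?_⟩
    have h1 : aeval (ψ.symm.conjAlgEquiv ℂ ρ) q = ψ.symm.conjAlgEquiv ℂ (aeval ρ q) :=
      aeval_algHom_apply (ψ.symm.conjAlgEquiv ℂ).toAlgHom ρ q
    have h2 : aeval ρ q = Algebra.lmul ℂ Q (aeval y q) :=
      aeval_algHom_apply (Algebra.lmul ℂ Q) y q
    apply ψ.injective
    rw [h1, h2]
    have h3 : aeval y q = ψ w := by
      ext i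
      rw [haeval, ← hz, Ideal.Quotient.eq, Ideal.mem_span_singleton]
      have h4 := _root_.map_dvd (compRingHom (X + C (s i - l i)))
        (Ideal.mem_span_singleton.1 (hq i))
      refine (pow_dvd_pow_of_dvd (hl i) _).trans ?_
      simpa [comp_assoc, add_sub_assoc, sub_eq_add_neg, add_assoc] using h4
    simp [LinearEquiv.conjAlgEquiv_apply, h3]

theorem exists_commute_isUnit_krylov {n : ℕ} (B : Matrix (Fin n) (Fin n) ℂ) :
    ∃ R : Matrix (Fin n) (Fin n) ℂ, Commute B R ∧ ∃ v, IsUnit (krylov R v) := by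
  obtain ⟨r, hr, v, hv⟩ := exists_commute_cyclic (toLin' B)
  obtain ⟨R, rfl⟩ := toLin'.surjective r
  refine ⟨R, toLin'.injective ?_, v, isUnit_krylov fun w => ?_⟩
  · rw [toLin'_mul, toLin'_mul]
    exact hr
  · obtain ⟨q, rfl⟩ := hv w
    refine ⟨q, ?_⟩
    have : aeval (toLin' R) q = toLin' (aeval R q) :=
      aeval_algHom_apply (toLinAlgEquiv' (R := ℂ) (n := Fin n)).toAlgHom R q
    rw [this, toLin'_apply]

/-- Every pair of commuting complex `n × n` matrices is a limit (in the standard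
topology on `M_n(ℂ) × M_n(ℂ)`) of pairs of simultaneously diagonalizable commuting
matrices each having `n` pairwise distinct eigenvalues; i.e., such pairs are dense
in the commuting variety. -/
theorem commuting_pairs_dense_simultaneously_diagonalizable
    {n : ℕ} (m₁ m₂ : Matrix (Fin n) (Fin n) ℂ) (h : m₁ * m₂ = m₂ * m₁) :
    (m₁, m₂) ∈ closure {p : Matrix (Fin n) (Fin n) ℂ × Matrix (Fin n) (Fin n) ℂ |
      ∃ g : (Matrix (Fin n) (Fin n) ℂ)ˣ, ∃ a b : Fin n → ℂ,
        Function.Injective a ∧ Function.Injective b ∧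
        (g : Matrix (Fin n) (Fin n) ℂ) * p.1 *
          ((g⁻¹ : (Matrix (Fin n) (Fin n) ℂ)ˣ) : Matrix (Fin n) (Fin n) ℂ) =
            Matrix.diagonal a ∧
        (g : Matrix (Fin n) (Fin n) ℂ) * p.2 *
          ((g⁻¹ : (Matrix (Fin n) (Fin n) ℂ)ˣ) : Matrix (Fin n) (Fin n) ℂ) =
            Matrix.diagonal b} := by
  change (m₁, m₂) ∈ closure (simpleSpectrumDiagonalizablePairs n)
  obtain ⟨R, hR, v, hv⟩ := exists_commute_isUnit_krylov m₂
  let N : Matrix (Fin n) (Fin n) ℂ[X] := m₁.map C + (X : ℂ[X]) • (R - m₁).map C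
  let P : ℂ[X] := (krylov N (C ∘ v)).det
  have hN (t : ℂ) : N.map (evalRingHom t) = m₁ + t • (R - m₁) := by
    ext i j
    simp [N]
  have hP (t : ℂ) : P.eval t = (krylov (m₁ + t • (R - m₁)) v).det := by
    have hv' : evalRingHom t ∘ C ∘ v = v := by
      funext j
      simp
    have hK := krylov_map (evalRingHom t) N (C ∘ v)
    rw [hN, hv'] at hK
    rw [← hK, ← RingHom.mapMatrix_apply, ← RingHom.map_det]
    rfl
  have hP0 : P ≠ 0 := by
    intro h0
    have h1 := hP 1
    rw [one_smul, add_sub_cancel, h0, eval_zero] at h1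
    exact ((isUnit_iff_isUnit_det _).1 hv).ne_zero h1.symm
  rw [← closure_closure]
  have hmem := mem_closure_of_eval_ne_zero (F := fun t => (m₁ + t • (R - m₁), m₂))
    (s := closure (simpleSpectrumDiagonalizablePairs n)) (by fun_prop) hP0 (fun t ht => ?_) 0
  · simpa only [zero_smul, add_zero] using hmem
  · have hcomm : Commute (m₁ + t • (R - m₁)) m₂ :=
      Commute.add_left h ((hR.symm.sub_left h).smul_left t)
    rw [hP, ← isUnit_iff_ne_zero, ← isUnit_iff_isUnit_det] at ht
    obtain ⟨p, hp⟩ := exists_aeval_eq_of_isUnit_krylov ht hcomm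
    simpa only [hp] using mem_closure_aeval (m₁ + t • (R - m₁)) p
end

section
/- For every matrix m ∈ M_n(ℂ) (n ≥ 1), the centralizer {x ∈ M_n(ℂ) : x·m = m·x}, which is a ℂ-linear subspace of M_n(ℂ), has ℂ-dimension at least n (and at most n²). -/
open Polynomial in
/-- A torsion `K[X]`-module structure on a finite-dimensional space is isomorphic to a finite product
of quotients of `K[X]`; multiplication in this product embeds the space into the commutant of the
given endomorphism. -/
theorem Module.End.exists_injective_commute {K V : Type*} [Field K] [AddCommGroup V] [Module K V]
    [FiniteDimensional K V] (f : Module.End K V) :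
    ∃ φ : V →ₗ[K] Module.End K V, Function.Injective φ ∧ ∀ v, Commute f (φ v) := by
  obtain ⟨ι, _, p, -, k, ⟨e₀⟩⟩ :=
    Module.equiv_directSum_of_isTorsion (Module.AEval.isTorsion_of_finiteDimensional K V f)
  classical
  let e : Module.AEval' f ≃ₗ[K[X]] (∀ i, K[X] ⧸ Ideal.span {p i ^ k i}) :=
    e₀.trans (DirectSum.linearEquivFunOnFintype K[X] ι _)
  let o := Module.AEval'.of f
  have smul_e (c : K) (v : V) : e (o (c • v)) = (C c : K[X]) • e (o v) := by
    rw [o.map_smul, ← e.map_smul, Module.AEval.C_smul]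
  have smul_o (c : K) (a) : o.symm (e.symm ((C c : K[X]) • a)) = c • o.symm (e.symm a) := by
    rw [e.symm.map_smul, ← o.symm.map_smul, Module.AEval.C_smul]
  have X_e (v : V) : e (o (f v)) = (X : K[X]) • e (o v) := by
    rw [← map_smul, Module.AEval'.X_smul_of]
  let φ : V →ₗ[K] Module.End K V := LinearMap.mk₂ K
    (fun v w ↦ o.symm (e.symm (e (o v) * e (o w))))
    (fun u v w ↦ by simp only [map_add, add_mul])
    (fun c v w ↦ by rw [smul_e, smul_mul_assoc, smul_o])
    (fun u v w ↦ by simp only [map_add, mul_add])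
    (fun c v w ↦ by rw [smul_e, mul_smul_comm, smul_o])
  have e_φ (v w : V) : e (o (φ v w)) = e (o v) * e (o w) := by simp [φ]
  have inj : Function.Injective fun v ↦ e (o v) := e.injective.comp o.injective
  refine ⟨φ, fun u v h ↦ inj ?_, fun v ↦ LinearMap.ext fun w ↦ inj ?_⟩
  · have := congrArg (fun g : Module.End K V ↦ e (o (g (o.symm (e.symm 1))))) h
    simpa [e_φ] using this
  · simp only [Module.End.mul_apply, X_e, e_φ, mul_smul_comm]


/-- For every `m ∈ M_n(ℂ)` with `n ≥ 1`, the centralizer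
`{x ∈ M_n(ℂ) : x * m = m * x}` has ℂ-dimension at least `n` and at most `n²`. -/
theorem centralizer_finrank_bounds
    {n : ℕ} (hn : 1 ≤ n) (m : Matrix (Fin n) (Fin n) ℂ) :
    n ≤ Module.finrank ℂ
        ↥(Subalgebra.centralizer ℂ ({m} : Set (Matrix (Fin n) (Fin n) ℂ))) ∧
    Module.finrank ℂ
        ↥(Subalgebra.centralizer ℂ ({m} : Set (Matrix (Fin n) (Fin n) ℂ))) ≤ n ^ 2 := by
  constructor
  · obtain ⟨φ, hφ, hcomm⟩ := Module.End.exists_injective_commute (Matrix.toLin' m)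
    let ψ : (Fin n → ℂ) →ₗ[ℂ] Matrix (Fin n) (Fin n) ℂ :=
      LinearMap.toMatrix'.toLinearMap ∘ₗ φ
    have hψ (v) : ψ v ∈ Subalgebra.toSubmodule (Subalgebra.centralizer ℂ {m}) := by
      rw [Subalgebra.mem_toSubmodule, Subalgebra.mem_centralizer_iff]
      rintro _ rfl
      have h := congrArg LinearMap.toMatrix' (hcomm v).eq
      rwa [LinearMap.toMatrix'_mul, LinearMap.toMatrix'_mul, LinearMap.toMatrix'_toLin'] at h
    have hinj : Function.Injective (ψ.codRestrict _ hψ) := fun u v h ↦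
      hφ (LinearMap.toMatrix'.injective (congrArg Subtype.val h))
    simpa using LinearMap.finrank_le_finrank_of_injective hinj
  · have h := Submodule.finrank_le (Subalgebra.toSubmodule (Subalgebra.centralizer ℂ {m}))
    simpa [Module.finrank_matrix, sq] using h
end
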